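/- arXiv:2504.21056 — 10 statements merged into one kernel-verified Lean document; each statement's English description precedes it below -/
import Mathlib

section
/- The spinorial configuration is non-degenerate: for any two distinct elements mu, mu' of P+ there are exactly two elements of P- incident to both of them, and dually, for any two distinct elements nu, nu' of P- there are exactly two elements of P+ incident to both of them. -/
/-- The number of nonzero coordinates of a sign vector in `(ℤ/2)^n`. -/
def wt {n : ℕ} (v : Fin n → ZMod 2) : ℕ := (Finset.univ.filter fun i => v i ≠ 0).card

/-- The weights of the positive half-spin representation of `Spin₁₀`, modelled as the
sign vectors with an even number of nonzero coordinates. -/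
def Pplus : Finset (Fin 5 → ZMod 2) := Finset.univ.filter fun v => Even (wt v)

/-- The weights of the negative half-spin representation of `Spin₁₀`, modelled as the
sign vectors with an odd number of nonzero coordinates. -/
def Pminus : Finset (Fin 5 → ZMod 2) := Finset.univ.filter fun v => ¬ Even (wt v)

/-- Hamming distance between two sign vectors. -/
def hdist (μ ν : Fin 5 → ZMod 2) : ℕ := (Finset.univ.filter fun i => μ i ≠ ν i).card

/-- The incidence relation of the spinorial configuration: two weights are incident
when they differ in exactly one coordinate or in all five coordinates. -/
def Incident (μ ν : Fin 5 → ZMod 2) : Prop := hdist μ ν = 1 ∨ hdist μ ν = 5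

instance (μ ν : Fin 5 → ZMod 2) : Decidable (Incident μ ν) := by
  unfold Incident; infer_instance

theorem natCast_wt {n : ℕ} (v : Fin n → ZMod 2) : (wt v : ZMod 2) = ∑ i, v i := by
  have key : ∀ a : ZMod 2, (if a ≠ 0 then 1 else 0) = a := by decide
  simp only [wt, Finset.card_filter, Nat.cast_sum, Nat.cast_ite, Nat.cast_one, Nat.cast_zero, key]

theorem even_wt_iff {n : ℕ} (v : Fin n → ZMod 2) : Even (wt v) ↔ ∑ i, v i = 0 := by
  rw [← natCast_wt, ZMod.natCast_eq_zero_iff_even]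

theorem even_wt_sub_iff {n : ℕ} (v w : Fin n → ZMod 2) :
    Even (wt (v - w)) ↔ (Even (wt v) ↔ Even (wt w)) := by
  have key : ∀ a b : ZMod 2, a - b = 0 ↔ (a = 0 ↔ b = 0) := by decide
  simp only [even_wt_iff, Pi.sub_apply, Finset.sum_sub_distrib, key]

theorem hdist_eq_wt_sub (μ ν : Fin 5 → ZMod 2) : hdist μ ν = wt (ν - μ) := by
  simp only [hdist, wt, Pi.sub_apply, sub_ne_zero, ne_comm]

theorem incident_comm (μ ν : Fin 5 → ZMod 2) : Incident μ ν ↔ Incident ν μ := by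
  simp only [Incident, hdist, ne_comm]

/-- Incidence is invariant under translation. -/
theorem incident_add_right (μ ν δ : Fin 5 → ZMod 2) :
    Incident (μ + δ) (ν + δ) ↔ Incident μ ν := by
  simp only [Incident, hdist_eq_wt_sub, add_sub_add_right_eq_sub]

theorem Incident.even_wt_iff_not {μ ν : Fin 5 → ZMod 2} (h : Incident μ ν) :
    Even (wt ν) ↔ ¬ Even (wt μ) := by
  have hodd : ¬ Even (wt (ν - μ)) := by
    rw [← hdist_eq_wt_sub]
    rcases h with h | h <;> rw [h] <;> decide
  rw [even_wt_sub_iff] at hodd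
  tauto

theorem card_incident_zero_and_incident :
    ∀ δ : Fin 5 → ZMod 2, Even (wt δ) → δ ≠ 0 →
      (Finset.univ.filter fun ν => Incident 0 ν ∧ Incident δ ν).card = 2 := by
  decide +kernel

/-- Two distinct weights of equal parity are incident to exactly two common weights. -/
theorem card_incident_and_incident {μ μ' : Fin 5 → ZMod 2}
    (hpar : Even (wt μ') ↔ Even (wt μ)) (hne : μ ≠ μ') :
    (Finset.univ.filter fun ν => Incident μ ν ∧ Incident μ' ν).card = 2 := by
  refine Eq.trans ?_ (card_incident_zero_and_incident (μ' - μ) ((even_wt_sub_iff μ' μ).2 hpar)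
    (sub_ne_zero.2 hne.symm))
  refine (Finset.card_equiv (Equiv.addRight μ) fun ν => ?_).symm
  have h₀ := incident_add_right 0 ν μ
  have h₁ := incident_add_right (μ' - μ) ν μ
  rw [zero_add] at h₀
  rw [sub_add_cancel] at h₁
  simp [h₀, h₁]

/-- The spinorial configuration is non-degenerate: any two distinct weights of `P₊` are
incident to exactly two common weights of `P₋`, and dually. -/
theorem spinorial_configuration_nondegenerate :
    (∀ μ ∈ Pplus, ∀ μ' ∈ Pplus, μ ≠ μ' →
      (Pminus.filter fun ν => Incident μ ν ∧ Incident μ' ν).card = 2) ∧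
    (∀ ν ∈ Pminus, ∀ ν' ∈ Pminus, ν ≠ ν' →
      (Pplus.filter fun μ => Incident μ ν ∧ Incident μ ν').card = 2) := by
  refine ⟨fun μ hμ μ' hμ' hne => ?_, fun ν hν ν' hν' hne => ?_⟩
  · simp only [Pplus, Finset.mem_filter_univ] at hμ hμ'
    refine (congrArg Finset.card (Finset.ext fun ν => ?_)).trans
      (card_incident_and_incident (iff_of_true hμ' hμ) hne)
    simp only [Pminus, Finset.mem_filter, Finset.mem_univ, true_and, and_iff_right_iff_imp]
    exact fun h hν => h.1.even_wt_iff_not.1 hν hμ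
  · simp only [Pminus, Finset.mem_filter_univ] at hν hν'
    refine (congrArg Finset.card (Finset.ext fun μ => ?_)).trans
      (card_incident_and_incident (iff_of_false hν' hν) hne)
    simp only [Pplus, Finset.mem_filter, Finset.mem_univ, true_and, incident_comm μ,
      and_iff_right_iff_imp]
    exact fun h => h.1.even_wt_iff_not.2 hν
end

section
/- The spinorial configuration coincides with the Kummer (grid) 16_6 configuration: there exist bijections f+ : P+ -> {0,1,2,3} x {0,1,2,3} and f- : P- -> {0,1,2,3} x {0,1,2,3} such that mu in P+ and nu in P- are incident if and only if f+(mu) and f-(nu) are distinct positions of the 4x4 grid lying in the same row or in the same column. -/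
/-- Incidence of the Kummer (grid) configuration on a 4×4 grid: two distinct positions are
incident when they lie in a common row or a common column. -/
def GridIncident (p q : Fin 4 × Fin 4) : Prop := p ≠ q ∧ (p.1 = q.1 ∨ p.2 = q.2)

/-- The linear map `v ↦ (v₀ + v₁, v₁ + v₂ ; v₃, v₄)` to `(ℤ/2)² × (ℤ/2)²`, with each factor
`(ℤ/2)²` labelled by `Fin 4`. -/
def gridPosition (v : Fin 5 → ZMod 2) : Fin 4 × Fin 4 :=
  (finProdFinEquiv (m := 2) (n := 2) (v 0 + v 1, v 1 + v 2),
    finProdFinEquiv (m := 2) (n := 2) (v 3, v 4))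

instance (p q : Fin 4 × Fin 4) : Decidable (GridIncident p q) := by
  unfold GridIncident; infer_instance

theorem bijective_gridPosition_Pplus :
    Function.Bijective fun v : {v // v ∈ Pplus} => gridPosition v := by
  rw [Fintype.bijective_iff_injective_and_card, Fintype.card_coe]
  refine ⟨?_, by decide +kernel⟩
  have h : ∀ u ∈ Pplus, ∀ v ∈ Pplus, gridPosition u = gridPosition v → u = v := by
    decide +kernel
  exact fun u v huv => Subtype.ext (h u u.2 v v.2 huv)

theorem bijective_gridPosition_Pminus :
    Function.Bijective fun v : {v // v ∈ Pminus} => gridPosition v := by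
  rw [Fintype.bijective_iff_injective_and_card, Fintype.card_coe]
  refine ⟨?_, by decide +kernel⟩
  have h : ∀ u ∈ Pminus, ∀ v ∈ Pminus, gridPosition u = gridPosition v → u = v := by
    decide +kernel
  exact fun u v huv => Subtype.ext (h u u.2 v v.2 huv)

theorem incident_iff_gridIncident_gridPosition :
    ∀ μ ∈ Pplus, ∀ ν ∈ Pminus,
      Incident μ ν ↔ GridIncident (gridPosition μ) (gridPosition ν) := by
  decide +kernel

/-- The spinorial configuration coincides with the Kummer (grid) `16₆` configuration: there
are bijections of `P₊` and `P₋` with the positions of a 4×4 grid matching the two incidence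
relations. -/
theorem spinorial_configuration_eq_kummer_configuration :
    ∃ (fp : {v // v ∈ Pplus} ≃ Fin 4 × Fin 4) (fm : {v // v ∈ Pminus} ≃ Fin 4 × Fin 4),
      ∀ (μ : {v // v ∈ Pplus}) (ν : {v // v ∈ Pminus}),
        Incident μ.1 ν.1 ↔ GridIncident (fp μ) (fm ν) := by
  exact ⟨Equiv.ofBijective _ bijective_gridPosition_Pplus,
    Equiv.ofBijective _ bijective_gridPosition_Pminus,
    fun μ ν => incident_iff_gridIncident_gridPosition μ μ.2 ν ν.2⟩
end

section
/- The following polynomial identity holds in Q[a1,a2,a3,a4] (expressing that the coefficients of the Kummer quartic K(a) associated with a point of the Cartan subspace satisfy the Segre cubic relation, i.e., the image of the Kummer map lies in the Segre cubic primal): 4*A^3 - (B^2 - C^2 - D^2 + E^2)*A + B*C*D = 0, where A, B, C, D, E are the explicit degree-12 polynomials given in the context. -/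
/-! The Hudson canonical-form coefficients `A, B, C, D, E` of the Kummer quartic surface
`K(a)` associated with a point `[a1 : a2 : a3 : a4]` of the Cartan subspace. -/

def coeffA (a1 a2 a3 a4 : ℚ) : ℚ :=
  4*a1*a2*a3*a4*(a1^4 - a2^4)*(a3^4 - a4^4)

def coeffB (a1 a2 a3 a4 : ℚ) : ℚ :=
  -(1/4)*a1^10*a3^2 + (5/4)*a1^8*a2^2*a3^2 - (5/2)*a1^6*a2^4*a3^2 + (5/2)*a1^4*a2^6*a3^2 - (5/4)*a1^2*a2^8*a3^2 + (1/4)*a2^10*a3^2 + (1/2)*a1^6*a3^6 + (5/2)*a1^4*a2^2*a3^6 - (5/2)*a1^2*a2^4*a3^6 - (1/2)*a2^6*a3^6 - (1/4)*a1^2*a3^10 + (1/4)*a2^2*a3^10 + (1/4)*a1^10*a4^2 - (5/4)*a1^8*a2^2*a4^2 + (5/2)*a1^6*a2^4*a4^2 - (5/2)*a1^4*a2^6*a4^2 + (5/4)*a1^2*a2^8*a4^2 - (1/4)*a2^10*a4^2 + (5/2)*a1^6*a3^4*a4^2 + (25/2)*a1^4*a2^2*a3^4*a4^2 - (25/2)*a1^2*a2^4*a3^4*a4^2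 - (5/2)*a2^6*a3^4*a4^2 + (5/4)*a1^2*a3^8*a4^2 - (5/4)*a2^2*a3^8*a4^2 - (5/2)*a1^6*a3^2*a4^4 - (25/2)*a1^4*a2^2*a3^2*a4^4 + (25/2)*a1^2*a2^4*a3^2*a4^4 + (5/2)*a2^6*a3^2*a4^4 - (5/2)*a1^2*a3^6*a4^4 + (5/2)*a2^2*a3^6*a4^4 - (1/2)*a1^6*a4^6 - (5/2)*a1^4*a2^2*a4^6 + (5/2)*a1^2*a2^4*a4^6 + (1/2)*a2^6*a4^6 + (5/2)*a1^2*a3^4*a4^6 - (5/2)*a2^2*a3^4*a4^6 - (5/4)*a1^2*a3^2*a4^8 + (5/4)*a2^2*a3^2*a4^8 + (1/4)*a1^2*a4^10 - (1/4)*a2^2*a4^10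

def coeffC (a1 a2 a3 a4 : ℚ) : ℚ :=
  (1/2)*a1^10*a3*a4 + (5/2)*a1^8*a2^2*a3*a4 + 5*a1^6*a2^4*a3*a4 + 5*a1^4*a2^6*a3*a4 + (5/2)*a1^2*a2^8*a3*a4 + (1/2)*a2^10*a3*a4 + 2*a1^6*a3^5*a4 - 10*a1^4*a2^2*a3^5*a4 - 10*a1^2*a2^4*a3^5*a4 + 2*a2^6*a3^5*a4 + 2*a1^6*a3*a4^5 - 10*a1^4*a2^2*a3*a4^5 - 10*a1^2*a2^4*a3*a4^5 + 2*a2^6*a3*a4^5 + 8*a1^2*a3^5*a4^5 + 8*a2^2*a3^5*a4^5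

def coeffD (a1 a2 a3 a4 : ℚ) : ℚ :=
  -8*a1^5*a2^5*a3^2 - 2*a1^5*a2*a3^6 - 2*a1*a2^5*a3^6 - (1/2)*a1*a2*a3^10 - 8*a1^5*a2^5*a4^2 + 10*a1^5*a2*a3^4*a4^2 + 10*a1*a2^5*a3^4*a4^2 - (5/2)*a1*a2*a3^8*a4^2 + 10*a1^5*a2*a3^2*a4^4 + 10*a1*a2^5*a3^2*a4^4 - 5*a1*a2*a3^6*a4^4 - 2*a1^5*a2*a4^6 - 2*a1*a2^5*a4^6 - 5*a1*a2*a3^4*a4^6 - (5/2)*a1*a2*a3^2*a4^8 - (1/2)*a1*a2*a4^10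

def coeffE (a1 a2 a3 a4 : ℚ) : ℚ :=
  -(1/2)*a1^10*a2^2 + a1^6*a2^6 - (1/2)*a1^2*a2^10 - (5/8)*a1^8*a3^4 + (5/2)*a1^6*a2^2*a3^4 + (25/4)*a1^4*a2^4*a3^4 + (5/2)*a1^2*a2^6*a3^4 - (5/8)*a2^8*a3^4 + (5/8)*a1^4*a3^8 + (5/4)*a1^2*a2^2*a3^8 + (5/8)*a2^4*a3^8 - (5/4)*a1^8*a3^2*a4^2 - 15*a1^6*a2^2*a3^2*a4^2 + (25/2)*a1^4*a2^4*a3^2*a4^2 - 15*a1^2*a2^6*a3^2*a4^2 - (5/4)*a2^8*a3^2*a4^2 - (5/2)*a1^4*a3^6*a4^2 + 15*a1^2*a2^2*a3^6*a4^2 - (5/2)*a2^4*a3^6*a4^2 + (1/2)*a3^10*a4^2 - (5/8)*a1^8*a4^4 + (5/2)*a1^6*a2^2*a4^4 + (25/4)*a1^4*a2^4*a4^4 + (5/2)*a1^2*a2^6*a4^4 - (5/8)*a2^8*a4^4 - (25/4)*a1^4*a3^4*a4^4 - (25/2)*a1^2*a2^2*a3^4*a4^4 - (25/4)*a2^4*a3^4*a4^4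 - (5/2)*a1^4*a3^2*a4^6 + 15*a1^2*a2^2*a3^2*a4^6 - (5/2)*a2^4*a3^2*a4^6 - a3^6*a4^6 + (5/8)*a1^4*a4^8 + (5/4)*a1^2*a2^2*a4^8 + (5/8)*a2^4*a4^8 + (1/2)*a3^2*a4^10

/-! With `p = a1² + a2²`, `m = a1² a2²`, `q = a3² + a4²`, `n = a3² a4²`, each coefficient is a
simple factor times a polynomial in `p, m, q, n`, and the Segre cubic relation reduces to an
identity in these four quantities. -/

theorem coeffA_eq (a1 a2 a3 a4 p q : ℚ) (hp : p = a1^2 + a2^2) (hq : q = a3^2 + a4^2) :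
    coeffA a1 a2 a3 a4
      = a1*a2*a3*a4*((a1^2 - a2^2)*(a3^2 - a4^2))*(4*p*q) := by
  subst hp hq
  rw [coeffA]
  ring

theorem coeffB_eq (a1 a2 a3 a4 p m q n : ℚ) (hp : p = a1^2 + a2^2) (hm : m = a1^2*a2^2)
    (hq : q = a3^2 + a4^2) (hn : n = a3^2*a4^2) :
    coeffB a1 a2 a3 a4
      = (a1^2 - a2^2)*(a3^2 - a4^2)
        * (-(p^2 - 4*m)^2/4 + (p^2 + 4*m)*(q^2 + 4*n)/2 - (q^2 - 4*n)^2/4) := by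
  subst hp hm hq hn
  rw [coeffB]
  ring

theorem coeffC_eq (a1 a2 a3 a4 p m q n : ℚ) (hp : p = a1^2 + a2^2) (hm : m = a1^2*a2^2)
    (hq : q = a3^2 + a4^2) (hn : n = a3^2*a4^2) :
    coeffC a1 a2 a3 a4
      = a3*a4*(p*(p^4/2 + 2*(p^2 - 8*m)*(q^2 - 2*n) + 8*n^2)) := by
  subst hp hm hq hn
  rw [coeffC]
  ring

theorem coeffD_eq (a1 a2 a3 a4 p m q n : ℚ) (hp : p = a1^2 + a2^2) (hm : m = a1^2*a2^2)
    (hq : q = a3^2 + a4^2) (hn : n = a3^2*a4^2) :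
    coeffD a1 a2 a3 a4
      = -(a1*a2*(q*(q^4/2 + 2*(q^2 - 8*n)*(p^2 - 2*m) + 8*m^2))) := by
  subst hp hm hq hn
  rw [coeffD]
  ring

theorem coeffE_eq (a1 a2 a3 a4 p m q n : ℚ) (hp : p = a1^2 + a2^2) (hm : m = a1^2*a2^2)
    (hq : q = a3^2 + a4^2) (hn : n = a3^2*a4^2) :
    coeffE a1 a2 a3 a4
      = -(m*p^2*(p^2 - 4*m))/2 + n*q^2*(q^2 - 4*n)/2
        - 5/8*p^4*q^2 + 5*p^2*m*q^2 - 20*p^2*m*n + 40*m^2*n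
        + 5/8*q^4*p^2 - 5*q^2*n*p^2 + 20*q^2*n*m - 40*n^2*m := by
  subst hp hm hq hn
  rw [coeffE]
  ring

/-- The coefficients of the Kummer quartic `K(a)` associated with any point of the Cartan
subspace satisfy the Segre cubic relation `4A³ - (B² - C² - D² + E²)A + BCD = 0`: the image
of the Kummer map lies in the Segre cubic primal. -/
theorem kummer_coefficients_satisfy_segre_cubic :
    ∀ a1 a2 a3 a4 : ℚ,
      4 * coeffA a1 a2 a3 a4 ^ 3
        - (coeffB a1 a2 a3 a4 ^ 2 - coeffC a1 a2 a3 a4 ^ 2 - coeffD a1 a2 a3 a4 ^ 2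
            + coeffE a1 a2 a3 a4 ^ 2) * coeffA a1 a2 a3 a4
        + coeffB a1 a2 a3 a4 * coeffC a1 a2 a3 a4 * coeffD a1 a2 a3 a4 = 0 := by
  intro a1 a2 a3 a4
  obtain ⟨p, hp⟩ : ∃ p, p = a1^2 + a2^2 := ⟨_, rfl⟩
  obtain ⟨m, hm⟩ : ∃ m, m = a1^2*a2^2 := ⟨_, rfl⟩
  obtain ⟨q, hq⟩ : ∃ q, q = a3^2 + a4^2 := ⟨_, rfl⟩
  obtain ⟨n, hn⟩ : ∃ n, n = a3^2*a4^2 := ⟨_, rfl⟩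
  rw [coeffA_eq a1 a2 a3 a4 p q hp hq, coeffB_eq a1 a2 a3 a4 p m q n hp hm hq hn,
    coeffC_eq a1 a2 a3 a4 p m q n hp hm hq hn, coeffD_eq a1 a2 a3 a4 p m q n hp hm hq hn,
    coeffE_eq a1 a2 a3 a4 p m q n hp hm hq hn]
  obtain ⟨u, hu⟩ : ∃ u, u = a1*a2 := ⟨_, rfl⟩
  obtain ⟨v, hv⟩ : ∃ v, v = a3*a4 := ⟨_, rfl⟩
  obtain ⟨d, hd⟩ : ∃ d, d = (a1^2 - a2^2)*(a3^2 - a4^2) := ⟨_, rfl⟩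
  have hu2 : m = u^2 := by rw [hm, hu]; ring
  have hv2 : n = v^2 := by rw [hn, hv]; ring
  have hd2 : d^2 = (p^2 - 4*m)*(q^2 - 4*n) := by rw [hd, hp, hm, hq, hn]; ring
  have huv : a1*a2*a3*a4 = u*v := by rw [hu, hv]; ring
  rw [huv, ← hu, ← hv, ← hd]
  rw [hu2, hv2] at hd2 ⊢
  linear_combination (256*u^3*v^3*d*p^3*q^3 - 4*u*v*d*p*q
    * (-(p^2 - 4*u^2)^2/4 + (p^2 + 4*u^2)*(q^2 + 4*v^2)/2 - (q^2 - 4*v^2)^2/4)^2) * hd2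
end

section
/- The fifteen degree-12 polynomials Dprod_i := product over j in D_i of ell_j (i = 1,...,15), each a product of twelve of the sixty reflection-hyperplane linear forms, span a complex vector subspace of dimension exactly 5 of the space of homogeneous degree-12 polynomials in C[a1,a2,a3,a4]; moreover Dprod_1 = ell_1*ell_2*...*ell_12 = a1*a2*a3*a4*(a1^4 - a2^4)*(a3^4 - a4^4). -/
/-- `II` denotes the constant `i` (a square root of `-1`) in `ℂ[a1, a2, a3, a4]`. -/
noncomputable def II : MvPolynomial (Fin 4) ℂ := MvPolynomial.C Complex.I

set_option maxHeartbeats 2000000 in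
/-- The sixty linear equations of the reflection hyperplanes of the complex reflection group
`G₃₁`, as linear forms in `ℂ[a1, a2, a3, a4]` (variables `X 0, X 1, X 2, X 3`). -/
noncomputable def ell : ℕ → MvPolynomial (Fin 4) ℂ
  | 1 => MvPolynomial.X 0
  | 2 => MvPolynomial.X 1
  | 3 => MvPolynomial.X 2
  | 4 => MvPolynomial.X 3
  | 5 => MvPolynomial.X 0 + MvPolynomial.X 1
  | 6 => MvPolynomial.X 0 + (-1 : MvPolynomial (Fin 4) ℂ) * MvPolynomial.X 1
  | 7 => MvPolynomial.X 2 + MvPolynomial.X 3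
  | 8 => MvPolynomial.X 2 + (-1 : MvPolynomial (Fin 4) ℂ) * MvPolynomial.X 3
  | 9 => MvPolynomial.X 0 + (II) * MvPolynomial.X 1
  | 10 => MvPolynomial.X 0 + (-II) * MvPolynomial.X 1
  | 11 => MvPolynomial.X 2 + (II) * MvPolynomial.X 3
  | 12 => MvPolynomial.X 2 + (-II) * MvPolynomial.X 3
  | 13 => MvPolynomial.X 0 + (II) * MvPolynomial.X 1 + (II+1) * MvPolynomial.X 2
  | 14 => MvPolynomial.X 0 + (II) * MvPolynomial.X 1 + (II-1) * MvPolynomial.X 2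
  | 15 => MvPolynomial.X 0 + (II) * MvPolynomial.X 1 + (-II+1) * MvPolynomial.X 2
  | 16 => MvPolynomial.X 0 + (II) * MvPolynomial.X 1 + (-II-1) * MvPolynomial.X 2
  | 17 => MvPolynomial.X 0 + (-II) * MvPolynomial.X 1 + (II+1) * MvPolynomial.X 2
  | 18 => MvPolynomial.X 0 + (-II) * MvPolynomial.X 1 + (II-1) * MvPolynomial.X 2
  | 19 => MvPolynomial.X 0 + (-II) * MvPolynomial.X 1 + (-II+1) * MvPolynomial.X 2
  | 20 => MvPolynomial.X 0 + (-II) * MvPolynomial.X 1 + (-II-1) * MvPolynomial.X 2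
  | 21 => MvPolynomial.X 0 + (II) * MvPolynomial.X 1 + (II+1) * MvPolynomial.X 3
  | 22 => MvPolynomial.X 0 + (II) * MvPolynomial.X 1 + (II-1) * MvPolynomial.X 3
  | 23 => MvPolynomial.X 0 + (II) * MvPolynomial.X 1 + (-II+1) * MvPolynomial.X 3
  | 24 => MvPolynomial.X 0 + (II) * MvPolynomial.X 1 + (-II-1) * MvPolynomial.X 3
  | 25 => MvPolynomial.X 0 + (-II) * MvPolynomial.X 1 + (II+1) * MvPolynomial.X 3
  | 26 => MvPolynomial.X 0 + (-II) * MvPolynomial.X 1 + (II-1) * MvPolynomial.X 3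
  | 27 => MvPolynomial.X 0 + (-II) * MvPolynomial.X 1 + (-II+1) * MvPolynomial.X 3
  | 28 => MvPolynomial.X 0 + (-II) * MvPolynomial.X 1 + (-II-1) * MvPolynomial.X 3
  | 29 => MvPolynomial.X 0 + MvPolynomial.X 1 + MvPolynomial.X 2 + MvPolynomial.X 3
  | 30 => MvPolynomial.X 0 + (-1 : MvPolynomial (Fin 4) ℂ) * MvPolynomial.X 1 + MvPolynomial.X 2 + MvPolynomial.X 3
  | 31 => MvPolynomial.X 0 + MvPolynomial.X 1 + (-1 : MvPolynomial (Fin 4) ℂ) * MvPolynomial.X 2 + MvPolynomial.X 3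
  | 32 => MvPolynomial.X 0 + MvPolynomial.X 1 + MvPolynomial.X 2 + (-1 : MvPolynomial (Fin 4) ℂ) * MvPolynomial.X 3
  | 33 => MvPolynomial.X 0 + (-1 : MvPolynomial (Fin 4) ℂ) * MvPolynomial.X 1 + (-1 : MvPolynomial (Fin 4) ℂ) * MvPolynomial.X 2 + MvPolynomial.X 3
  | 34 => MvPolynomial.X 0 + (-1 : MvPolynomial (Fin 4) ℂ) * MvPolynomial.X 1 + MvPolynomial.X 2 + (-1 : MvPolynomial (Fin 4) ℂ) * MvPolynomial.X 3
  | 35 => MvPolynomial.X 0 + MvPolynomial.X 1 + (-1 : MvPolynomial (Fin 4) ℂ) * MvPolynomial.X 2 + (-1 : MvPolynomial (Fin 4) ℂ) * MvPolynomial.X 3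
  | 36 => MvPolynomial.X 0 + (-1 : MvPolynomial (Fin 4) ℂ) * MvPolynomial.X 1 + (-1 : MvPolynomial (Fin 4) ℂ) * MvPolynomial.X 2 + (-1 : MvPolynomial (Fin 4) ℂ) * MvPolynomial.X 3
  | 37 => MvPolynomial.X 0 + MvPolynomial.X 1 + (II) * MvPolynomial.X 2 + (II) * MvPolynomial.X 3
  | 38 => MvPolynomial.X 0 + (-1 : MvPolynomial (Fin 4) ℂ) * MvPolynomial.X 1 + (II) * MvPolynomial.X 2 + (II) * MvPolynomial.X 3
  | 39 => MvPolynomial.X 0 + MvPolynomial.X 1 + (-II) * MvPolynomial.X 2 + (II) * MvPolynomial.X 3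
  | 40 => MvPolynomial.X 0 + MvPolynomial.X 1 + (II) * MvPolynomial.X 2 + (-II) * MvPolynomial.X 3
  | 41 => MvPolynomial.X 0 + (-1 : MvPolynomial (Fin 4) ℂ) * MvPolynomial.X 1 + (-II) * MvPolynomial.X 2 + (II) * MvPolynomial.X 3
  | 42 => MvPolynomial.X 0 + (-1 : MvPolynomial (Fin 4) ℂ) * MvPolynomial.X 1 + (II) * MvPolynomial.X 2 + (-II) * MvPolynomial.X 3
  | 43 => MvPolynomial.X 0 + MvPolynomial.X 1 + (-II) * MvPolynomial.X 2 + (-II) * MvPolynomial.X 3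
  | 44 => MvPolynomial.X 0 + (-1 : MvPolynomial (Fin 4) ℂ) * MvPolynomial.X 1 + (-II) * MvPolynomial.X 2 + (-II) * MvPolynomial.X 3
  | 45 => (II+1) * MvPolynomial.X 0 + (II) * MvPolynomial.X 2 + (-1 : MvPolynomial (Fin 4) ℂ) * MvPolynomial.X 3
  | 46 => (II+1) * MvPolynomial.X 0 + (II) * MvPolynomial.X 2 + MvPolynomial.X 3
  | 47 => (II-1) * MvPolynomial.X 0 + (-II) * MvPolynomial.X 2 + (-1 : MvPolynomial (Fin 4) ℂ) * MvPolynomial.X 3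
  | 48 => (II-1) * MvPolynomial.X 0 + (-II) * MvPolynomial.X 2 + MvPolynomial.X 3
  | 49 => (II-1) * MvPolynomial.X 0 + (II) * MvPolynomial.X 2 + (-1 : MvPolynomial (Fin 4) ℂ) * MvPolynomial.X 3
  | 50 => (II-1) * MvPolynomial.X 0 + (II) * MvPolynomial.X 2 + MvPolynomial.X 3
  | 51 => (II+1) * MvPolynomial.X 0 + (-II) * MvPolynomial.X 2 + (-1 : MvPolynomial (Fin 4) ℂ) * MvPolynomial.X 3
  | 52 => (II+1) * MvPolynomial.X 0 + (-II) * MvPolynomial.X 2 + MvPolynomial.X 3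
  | 53 => (II+1) * MvPolynomial.X 1 + (II) * MvPolynomial.X 2 + (-1 : MvPolynomial (Fin 4) ℂ) * MvPolynomial.X 3
  | 54 => (II+1) * MvPolynomial.X 1 + (II) * MvPolynomial.X 2 + MvPolynomial.X 3
  | 55 => (II-1) * MvPolynomial.X 1 + (-II) * MvPolynomial.X 2 + (-1 : MvPolynomial (Fin 4) ℂ) * MvPolynomial.X 3
  | 56 => (II-1) * MvPolynomial.X 1 + (-II) * MvPolynomial.X 2 + MvPolynomial.X 3
  | 57 => (II-1) * MvPolynomial.X 1 + (II) * MvPolynomial.X 2 + (-1 : MvPolynomial (Fin 4) ℂ) * MvPolynomial.X 3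
  | 58 => (II-1) * MvPolynomial.X 1 + (II) * MvPolynomial.X 2 + MvPolynomial.X 3
  | 59 => (II+1) * MvPolynomial.X 1 + (-II) * MvPolynomial.X 2 + (-1 : MvPolynomial (Fin 4) ℂ) * MvPolynomial.X 3
  | 60 => (II+1) * MvPolynomial.X 1 + (-II) * MvPolynomial.X 2 + MvPolynomial.X 3
  | _ => 0

/-- The fifteen blocks: 12-element subsets of `{1, …, 60}` indexing the reflection
hyperplanes occurring in each of the fifteen degree-12 products. -/
def Dblock : ℕ → Finset ℕ
  | 1 => {1,2,3,4,5,6,7,8,9,10,11,12}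
  | 2 => {1,2,11,12,45,48,49,52,54,55,58,59}
  | 3 => {1,2,11,12,46,47,50,51,53,56,57,60}
  | 4 => {3,4,9,10,13,14,15,16,25,26,27,28}
  | 5 => {3,4,9,10,17,18,19,20,21,22,23,24}
  | 6 => {5,6,7,8,29,33,34,35,37,41,42,43}
  | 7 => {5,6,7,8,30,31,32,36,38,39,40,44}
  | 8 => {18,19,21,24,31,32,38,44,47,50,53,60}
  | 9 => {14,15,25,28,33,34,37,43,47,50,53,60}
  | 10 => {18,19,21,24,29,35,41,42,48,49,54,59}
  | 11 => {14,15,25,28,30,36,39,40,48,49,54,59}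
  | 12 => {13,16,26,27,31,32,38,44,45,52,55,58}
  | 13 => {17,20,22,23,33,34,37,43,45,52,55,58}
  | 14 => {13,16,26,27,29,35,41,42,46,51,56,57}
  | 15 => {17,20,22,23,30,36,39,40,46,51,56,57}
  | _ => ∅

/-- The degree-12 product of the reflection-hyperplane linear forms of the `i`-th block. -/
noncomputable def Dprod (i : ℕ) : MvPolynomial (Fin 4) ℂ := ∏ j ∈ Dblock i, ell j

section

open MvPolynomial

theorem II_sq : II ^ 2 = -1 := by
  simp [II, ← map_pow]

/-! ### Five quartic forms

Each block is a union of three four-element sets, and the product of the linear forms over each of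
these sets is a linear combination of the five quartic forms below. -/

/-- The quartic form `a1 a2 (a3² + a4²)`. -/
noncomputable def formU : MvPolynomial (Fin 4) ℂ := X 0 * X 1 * (X 2 ^ 2 + X 3 ^ 2)

/-- The quartic form `a3 a4 (a1² + a2²)`. -/
noncomputable def formV : MvPolynomial (Fin 4) ℂ := X 2 * X 3 * (X 0 ^ 2 + X 1 ^ 2)

/-- The quartic form `(a1² - a2²) (a3² - a4²)`. -/
noncomputable def formT : MvPolynomial (Fin 4) ℂ := (X 0 ^ 2 - X 1 ^ 2) * (X 2 ^ 2 - X 3 ^ 2)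

/-- The quartic form `(a1² + a2²)² + 4 a3² a4²`. -/
noncomputable def formA : MvPolynomial (Fin 4) ℂ :=
  (X 0 ^ 2 + X 1 ^ 2) ^ 2 + 4 * (X 2 ^ 2 * X 3 ^ 2)

/-- The quartic form `4 a1² a2² + (a3² + a4²)²`. -/
noncomputable def formC : MvPolynomial (Fin 4) ℂ :=
  4 * (X 0 ^ 2 * X 1 ^ 2) + (X 2 ^ 2 + X 3 ^ 2) ^ 2

/-! ### Products of four linear forms -/

theorem prod_four {M : Type*} [CommMonoid M] (f : ℕ → M) {a b c d : ℕ} (h : [a, b, c, d].Nodup) :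
    ∏ j ∈ ({a, b, c, d} : Finset ℕ), f j = f a * f b * f c * f d := by
  have := List.prod_toFinset f h
  simpa [mul_assoc] using this

theorem prod_ell_1_2_11_12 :
    ∏ j ∈ {1, 2, 11, 12}, ell j = formU := by
  rw [prod_four ell (by decide)]
  simp only [ell, formU]
  grind [II_sq]

theorem prod_ell_3_4_9_10 :
    ∏ j ∈ {3, 4, 9, 10}, ell j = formV := by
  rw [prod_four ell (by decide)]
  simp only [ell, formV]
  grind [II_sq]

theorem prod_ell_5_6_7_8 :
    ∏ j ∈ {5, 6, 7, 8}, ell j = formT := by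
  rw [prod_four ell (by decide)]
  simp only [ell, formT]
  grind [II_sq]

theorem prod_ell_13_16_26_27 :
    ∏ j ∈ {13, 16, 26, 27}, ell j = formA - 2 * II * formT - 4 * formU := by
  rw [prod_four ell (by decide)]
  simp only [ell, formU, formT, formA]
  grind [II_sq]

theorem prod_ell_14_15_25_28 :
    ∏ j ∈ {14, 15, 25, 28}, ell j = formA + 2 * II * formT + 4 * formU := by
  rw [prod_four ell (by decide)]
  simp only [ell, formU, formT, formA]
  grind [II_sq]

theorem prod_ell_17_20_22_23 :
    ∏ j ∈ {17, 20, 22, 23}, ell j = formA - 2 * II * formT + 4 * formU := by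
  rw [prod_four ell (by decide)]
  simp only [ell, formU, formT, formA]
  grind [II_sq]

theorem prod_ell_18_19_21_24 :
    ∏ j ∈ {18, 19, 21, 24}, ell j = formA + 2 * II * formT - 4 * formU := by
  rw [prod_four ell (by decide)]
  simp only [ell, formU, formT, formA]
  grind [II_sq]

theorem prod_ell_29_35_41_42 :
    ∏ j ∈ {29, 35, 41, 42}, ell j = formA - formC - 4 * formV + 4 * formU := by
  rw [prod_four ell (by decide)]
  simp only [ell, formU, formV, formA, formC]
  grind [II_sq]

theorem prod_ell_30_36_39_40 :
    ∏ j ∈ {30, 36, 39, 40}, ell j = formA - formC - 4 * formV - 4 * formU := by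
  rw [prod_four ell (by decide)]
  simp only [ell, formU, formV, formA, formC]
  grind [II_sq]

theorem prod_ell_31_32_38_44 :
    ∏ j ∈ {31, 32, 38, 44}, ell j = formA - formC + 4 * formV + 4 * formU := by
  rw [prod_four ell (by decide)]
  simp only [ell, formU, formV, formA, formC]
  grind [II_sq]

theorem prod_ell_33_34_37_43 :
    ∏ j ∈ {33, 34, 37, 43}, ell j = formA - formC + 4 * formV - 4 * formU := by
  rw [prod_four ell (by decide)]
  simp only [ell, formU, formV, formA, formC]
  grind [II_sq]

theorem prod_ell_45_52_55_58 :
    ∏ j ∈ {45, 52, 55, 58}, ell j = formC + 2 * II * formT + 4 * formV := by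
  rw [prod_four ell (by decide)]
  simp only [ell, formV, formT, formC]
  grind [II_sq]

theorem prod_ell_46_51_56_57 :
    ∏ j ∈ {46, 51, 56, 57}, ell j = formC + 2 * II * formT - 4 * formV := by
  rw [prod_four ell (by decide)]
  simp only [ell, formV, formT, formC]
  grind [II_sq]

theorem prod_ell_47_50_53_60 :
    ∏ j ∈ {47, 50, 53, 60}, ell j = formC - 2 * II * formT + 4 * formV := by
  rw [prod_four ell (by decide)]
  simp only [ell, formV, formT, formC]
  grind [II_sq]

theorem prod_ell_48_49_54_59 :
    ∏ j ∈ {48, 49, 54, 59}, ell j = formC - 2 * II * formT - 4 * formV := by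
  rw [prod_four ell (by decide)]
  simp only [ell, formV, formT, formC]
  grind [II_sq]

/-! ### The block products in terms of the quartic forms -/

theorem Dprod_eq_mul {i : ℕ} (s t r : Finset ℕ) (h : Dblock i = s ∪ t ∪ r)
    (hst : Disjoint s t) (hr : Disjoint (s ∪ t) r) :
    Dprod i = (∏ j ∈ s, ell j) * (∏ j ∈ t, ell j) * ∏ j ∈ r, ell j := by
  rw [Dprod, h, Finset.prod_union hr, Finset.prod_union hst]

theorem Dprod_1_eq : Dprod 1 = formU *formV *formT := by
  rw [Dprod_eq_mul {1, 2, 11, 12} {3, 4, 9, 10} {5, 6, 7, 8}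
    (by decide) (by decide) (by decide),
    prod_ell_1_2_11_12, prod_ell_3_4_9_10, prod_ell_5_6_7_8]

theorem Dprod_2_eq : Dprod 2 = formU *
      (formC + 2 * II * formT + 4 * formV) *
      (formC - 2 * II * formT - 4 * formV) := by
  rw [Dprod_eq_mul {1, 2, 11, 12} {45, 52, 55, 58} {48, 49, 54, 59}
    (by decide) (by decide) (by decide),
    prod_ell_1_2_11_12, prod_ell_45_52_55_58, prod_ell_48_49_54_59]

theorem Dprod_3_eq : Dprod 3 = formU *
      (formC + 2 * II * formT - 4 * formV) *
      (formC - 2 * II * formT + 4 * formV) := by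
  rw [Dprod_eq_mul {1, 2, 11, 12} {46, 51, 56, 57} {47, 50, 53, 60}
    (by decide) (by decide) (by decide),
    prod_ell_1_2_11_12, prod_ell_46_51_56_57, prod_ell_47_50_53_60]

theorem Dprod_4_eq : Dprod 4 = formV *
      (formA - 2 * II * formT - 4 * formU) *
      (formA + 2 * II * formT + 4 * formU) := by
  rw [Dprod_eq_mul {3, 4, 9, 10} {13, 16, 26, 27} {14, 15, 25, 28}
    (by decide) (by decide) (by decide),
    prod_ell_3_4_9_10, prod_ell_13_16_26_27, prod_ell_14_15_25_28]

theorem Dprod_5_eq : Dprod 5 = formV *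
      (formA - 2 * II * formT + 4 * formU) *
      (formA + 2 * II * formT - 4 * formU) := by
  rw [Dprod_eq_mul {3, 4, 9, 10} {17, 20, 22, 23} {18, 19, 21, 24}
    (by decide) (by decide) (by decide),
    prod_ell_3_4_9_10, prod_ell_17_20_22_23, prod_ell_18_19_21_24]

theorem Dprod_6_eq : Dprod 6 = formT *
      (formA - formC - 4 * formV + 4 * formU) *
      (formA - formC + 4 * formV - 4 * formU) := by
  rw [Dprod_eq_mul {5, 6, 7, 8} {29, 35, 41, 42} {33, 34, 37, 43}
    (by decide) (by decide) (by decide),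
    prod_ell_5_6_7_8, prod_ell_29_35_41_42, prod_ell_33_34_37_43]

theorem Dprod_7_eq : Dprod 7 = formT *
      (formA - formC - 4 * formV - 4 * formU) *
      (formA - formC + 4 * formV + 4 * formU) := by
  rw [Dprod_eq_mul {5, 6, 7, 8} {30, 36, 39, 40} {31, 32, 38, 44}
    (by decide) (by decide) (by decide),
    prod_ell_5_6_7_8, prod_ell_30_36_39_40, prod_ell_31_32_38_44]

theorem Dprod_8_eq : Dprod 8 = (formA + 2 * II * formT - 4 * formU) *
      (formA - formC + 4 * formV + 4 * formU) *
      (formC - 2 * II * formT + 4 * formV) := by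
  rw [Dprod_eq_mul {18, 19, 21, 24} {31, 32, 38, 44} {47, 50, 53, 60}
    (by decide) (by decide) (by decide),
    prod_ell_18_19_21_24, prod_ell_31_32_38_44, prod_ell_47_50_53_60]

theorem Dprod_9_eq : Dprod 9 = (formA + 2 * II * formT + 4 * formU) *
      (formA - formC + 4 * formV - 4 * formU) *
      (formC - 2 * II * formT + 4 * formV) := by
  rw [Dprod_eq_mul {14, 15, 25, 28} {33, 34, 37, 43} {47, 50, 53, 60}
    (by decide) (by decide) (by decide),
    prod_ell_14_15_25_28, prod_ell_33_34_37_43, prod_ell_47_50_53_60]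

theorem Dprod_10_eq : Dprod 10 = (formA + 2 * II * formT - 4 * formU) *
      (formA - formC - 4 * formV + 4 * formU) *
      (formC - 2 * II * formT - 4 * formV) := by
  rw [Dprod_eq_mul {18, 19, 21, 24} {29, 35, 41, 42} {48, 49, 54, 59}
    (by decide) (by decide) (by decide),
    prod_ell_18_19_21_24, prod_ell_29_35_41_42, prod_ell_48_49_54_59]

theorem Dprod_11_eq : Dprod 11 = (formA + 2 * II * formT + 4 * formU) *
      (formA - formC - 4 * formV - 4 * formU) *
      (formC - 2 * II * formT - 4 * formV) := by
  rw [Dprod_eq_mul {14, 15, 25, 28} {30, 36, 39, 40} {48, 49, 54, 59}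
    (by decide) (by decide) (by decide),
    prod_ell_14_15_25_28, prod_ell_30_36_39_40, prod_ell_48_49_54_59]

theorem Dprod_12_eq : Dprod 12 = (formA - 2 * II * formT - 4 * formU) *
      (formA - formC + 4 * formV + 4 * formU) *
      (formC + 2 * II * formT + 4 * formV) := by
  rw [Dprod_eq_mul {13, 16, 26, 27} {31, 32, 38, 44} {45, 52, 55, 58}
    (by decide) (by decide) (by decide),
    prod_ell_13_16_26_27, prod_ell_31_32_38_44, prod_ell_45_52_55_58]

theorem Dprod_13_eq : Dprod 13 = (formA - 2 * II * formT + 4 * formU) *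
      (formA - formC + 4 * formV - 4 * formU) *
      (formC + 2 * II * formT + 4 * formV) := by
  rw [Dprod_eq_mul {17, 20, 22, 23} {33, 34, 37, 43} {45, 52, 55, 58}
    (by decide) (by decide) (by decide),
    prod_ell_17_20_22_23, prod_ell_33_34_37_43, prod_ell_45_52_55_58]

theorem Dprod_14_eq : Dprod 14 = (formA - 2 * II * formT - 4 * formU) *
      (formA - formC - 4 * formV + 4 * formU) *
      (formC + 2 * II * formT - 4 * formV) := by
  rw [Dprod_eq_mul {13, 16, 26, 27} {29, 35, 41, 42} {46, 51, 56, 57}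
    (by decide) (by decide) (by decide),
    prod_ell_13_16_26_27, prod_ell_29_35_41_42, prod_ell_46_51_56_57]

theorem Dprod_15_eq : Dprod 15 = (formA - 2 * II * formT + 4 * formU) *
      (formA - formC - 4 * formV - 4 * formU) *
      (formC + 2 * II * formT - 4 * formV) := by
  rw [Dprod_eq_mul {17, 20, 22, 23} {30, 36, 39, 40} {46, 51, 56, 57}
    (by decide) (by decide) (by decide),
    prod_ell_17_20_22_23, prod_ell_30_36_39_40, prod_ell_46_51_56_57]

/-! ### The linear relations -/

theorem Dprod_3_relation : Dprod 3 = Dprod 2 + (32 * Complex.I : ℂ) • Dprod 1 := by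
  have hc : (C (32 * Complex.I) : MvPolynomial (Fin 4) ℂ) = 32 * II := by
    rw [map_mul, map_ofNat, II]
  rw [smul_eq_C_mul, hc, Dprod_3_eq, Dprod_2_eq, Dprod_1_eq]
  ring

theorem Dprod_5_relation : Dprod 5 = Dprod 4 + (32 * Complex.I : ℂ) • Dprod 1 := by
  have hc : (C (32 * Complex.I) : MvPolynomial (Fin 4) ℂ) = 32 * II := by
    rw [map_mul, map_ofNat, II]
  rw [smul_eq_C_mul, hc, Dprod_5_eq, Dprod_4_eq, Dprod_1_eq]
  ring

theorem Dprod_7_relation : Dprod 7 = Dprod 6 + (-64 : ℂ) • Dprod 1 := by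
  have hc : (C (-64) : MvPolynomial (Fin 4) ℂ) = -64 := by
    rw [map_neg, map_ofNat]
  rw [smul_eq_C_mul, hc, Dprod_7_eq, Dprod_6_eq, Dprod_1_eq]
  ring

theorem Dprod_9_relation : Dprod 9 = Dprod 8 + (-8 : ℂ) • Dprod 3 := by
  have hc : (C (-8) : MvPolynomial (Fin 4) ℂ) = -8 := by
    rw [map_neg, map_ofNat]
  rw [smul_eq_C_mul, hc, Dprod_9_eq, Dprod_8_eq, Dprod_3_eq]
  ring

theorem Dprod_10_relation : Dprod 10 = Dprod 8 + (-8 : ℂ) • Dprod 5 := by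
  have hc : (C (-8) : MvPolynomial (Fin 4) ℂ) = -8 := by
    rw [map_neg, map_ofNat]
  rw [smul_eq_C_mul, hc, Dprod_10_eq, Dprod_8_eq, Dprod_5_eq]
  ring

theorem Dprod_11_relation : Dprod 11 = Dprod 9 + (-8 : ℂ) • Dprod 4 := by
  have hc : (C (-8) : MvPolynomial (Fin 4) ℂ) = -8 := by
    rw [map_neg, map_ofNat]
  rw [smul_eq_C_mul, hc, Dprod_11_eq, Dprod_9_eq, Dprod_4_eq]
  ring

theorem Dprod_12_relation : Dprod 12 = Dprod 8 + (4 * Complex.I : ℂ) • Dprod 7 := by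
  have hc : (C (4 * Complex.I) : MvPolynomial (Fin 4) ℂ) = 4 * II := by
    rw [map_mul, map_ofNat, II]
  rw [smul_eq_C_mul, hc, Dprod_12_eq, Dprod_8_eq, Dprod_7_eq]
  ring

theorem Dprod_13_relation : Dprod 13 = Dprod 9 + (4 * Complex.I : ℂ) • Dprod 6 := by
  have hc : (C (4 * Complex.I) : MvPolynomial (Fin 4) ℂ) = 4 * II := by
    rw [map_mul, map_ofNat, II]
  rw [smul_eq_C_mul, hc, Dprod_13_eq, Dprod_9_eq, Dprod_6_eq]
  ring

theorem Dprod_14_relation : Dprod 14 = Dprod 10 + (4 * Complex.I : ℂ) • Dprod 6 := by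
  have hc : (C (4 * Complex.I) : MvPolynomial (Fin 4) ℂ) = 4 * II := by
    rw [map_mul, map_ofNat, II]
  rw [smul_eq_C_mul, hc, Dprod_14_eq, Dprod_10_eq, Dprod_6_eq]
  ring

theorem Dprod_15_relation : Dprod 15 = Dprod 13 + (-8 : ℂ) • Dprod 5 := by
  have hc : (C (-8) : MvPolynomial (Fin 4) ℂ) = -8 := by
    rw [map_neg, map_ofNat]
  rw [smul_eq_C_mul, hc, Dprod_15_eq, Dprod_13_eq, Dprod_5_eq]
  ring

/-! ### A basis of the span -/

/-- Five blocks whose products form a basis of the span of all fifteen. -/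
noncomputable def basisProd : Fin 5 → MvPolynomial (Fin 4) ℂ :=
  ![Dprod 1, Dprod 2, Dprod 4, Dprod 6, Dprod 8]

theorem linearIndependent_basisProd : LinearIndependent ℂ basisProd := by
  rw [Fintype.linearIndependent_iff]
  intro g hg
  have key (p : Fin 4 → ℂ) := congrArg (eval p) hg
  simp only [basisProd, Fin.sum_univ_five, Matrix.cons_val, smul_eq_C_mul, map_add, map_mul,
    eval_C, map_zero, Dprod_1_eq, Dprod_2_eq, Dprod_4_eq, Dprod_6_eq, Dprod_8_eq, formU, formV,
    formT, formA, formC, II, map_sub, map_pow, eval_X, map_ofNat] at key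
  have h4 : g 4 = 0 := by
    have := key ![0, 0, 1, 2]
    simp only [Matrix.cons_val] at this
    linear_combination (-1 / 3600) * this
  have h2 : g 2 = 0 := by
    have := key ![0, 1, 1, -1]
    simp only [Matrix.cons_val] at this
    linear_combination (-1 / 25) * this
  have h1 : g 1 = 0 := by
    have := key ![1, 1, 0, 1]
    simp only [Matrix.cons_val] at this
    linear_combination (1 / 25) * this
  have h3 : g 3 = 0 := by
    have := key ![0, 1, 0, 2]
    simp only [Matrix.cons_val, h4] at this
    linear_combination (1 / 900) * this
  have h0 : g 0 = 0 := by
    have := key ![1, 2, 1, 2]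
    simp only [Matrix.cons_val, h1, h2, h3, h4] at this
    linear_combination (1 / 900) * this
  intro i
  fin_cases i <;> assumption

theorem Dprod_mem_of_basisProd_mem {S : Submodule ℂ (MvPolynomial (Fin 4) ℂ)}
    (hS : ∀ k, basisProd k ∈ S) {i : ℕ} (hi : i ∈ Set.Icc 1 15) : Dprod i ∈ S := by
  have add_smul_mem {p q r : MvPolynomial (Fin 4) ℂ} {c : ℂ} (h : r = p + c • q) (hp : p ∈ S)
      (hq : q ∈ S) : r ∈ S :=
    h ▸ add_mem hp (S.smul_mem c hq)
  have h1 : Dprod 1 ∈ S := hS 0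
  have h2 : Dprod 2 ∈ S := hS 1
  have h4 : Dprod 4 ∈ S := hS 2
  have h6 : Dprod 6 ∈ S := hS 3
  have h8 : Dprod 8 ∈ S := hS 4
  have h3 := add_smul_mem Dprod_3_relation h2 h1
  have h5 := add_smul_mem Dprod_5_relation h4 h1
  have h7 := add_smul_mem Dprod_7_relation h6 h1
  have h9 := add_smul_mem Dprod_9_relation h8 h3
  have h10 := add_smul_mem Dprod_10_relation h8 h5
  have h11 := add_smul_mem Dprod_11_relation h9 h4
  have h12 := add_smul_mem Dprod_12_relation h8 h7
  have h13 := add_smul_mem Dprod_13_relation h9 h6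
  have h14 := add_smul_mem Dprod_14_relation h10 h6
  have h15 := add_smul_mem Dprod_15_relation h13 h5
  obtain ⟨hi1, hi15⟩ := hi
  interval_cases i
  exacts [h1, h2, h3, h4, h5, h6, h7, h8, h9, h10, h11, h12, h13, h14, h15]

theorem basisProd_mem_image (k : Fin 5) : basisProd k ∈ Dprod '' Set.Icc 1 15 := by
  fin_cases k
  exacts [⟨1, by simp, rfl⟩, ⟨2, by simp, rfl⟩, ⟨4, by simp, rfl⟩, ⟨6, by simp, rfl⟩,
    ⟨8, by simp, rfl⟩]

theorem span_Dprod_eq :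
    Submodule.span ℂ (Dprod '' Set.Icc 1 15) = Submodule.span ℂ (Set.range basisProd) := by
  apply le_antisymm
  · rw [Submodule.span_le]
    rintro _ ⟨i, hi, rfl⟩
    exact Dprod_mem_of_basisProd_mem (fun k => Submodule.subset_span (Set.mem_range_self k)) hi
  · apply Submodule.span_mono
    rintro _ ⟨k, rfl⟩
    exact basisProd_mem_image k

theorem finrank_span_Dprod :
    Module.finrank ℂ (Submodule.span ℂ (Dprod '' Set.Icc 1 15)) = 5 := by
  rw [span_Dprod_eq, finrank_span_eq_card linearIndependent_basisProd, Fintype.card_fin]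

/-! ### Homogeneity -/

theorem basisProd_isHomogeneous (k : Fin 5) : (basisProd k).IsHomogeneous 12 := by
  have hX (m : Fin 4) : (X m : MvPolynomial (Fin 4) ℂ).IsHomogeneous 1 := isHomogeneous_X _ _
  have hsq (m : Fin 4) : (X m ^ 2 : MvPolynomial (Fin 4) ℂ).IsHomogeneous 2 := (hX m).pow 2
  have smul {c p : MvPolynomial (Fin 4) ℂ} (hc : c.IsHomogeneous 0) (hp : p.IsHomogeneous 4) :
      (c * p).IsHomogeneous 4 := by simpa using hc.mul hp
  have h4 : (4 : MvPolynomial (Fin 4) ℂ).IsHomogeneous 0 := isHomogeneous_C _ (4 : ℂ)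
  have h2I : (2 * II).IsHomogeneous 0 := (isHomogeneous_C _ (2 : ℂ)).mul (isHomogeneous_C _ _)
  have hU : formU.IsHomogeneous 4 := ((hX 0).mul (hX 1)).mul ((hsq 2).add (hsq 3))
  have hV : formV.IsHomogeneous 4 := ((hX 2).mul (hX 3)).mul ((hsq 0).add (hsq 1))
  have hT : formT.IsHomogeneous 4 := ((hsq 0).sub (hsq 1)).mul ((hsq 2).sub (hsq 3))
  have hA : formA.IsHomogeneous 4 :=
    (((hsq 0).add (hsq 1)).pow 2).add (smul h4 ((hsq 2).mul (hsq 3)))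
  have hC : formC.IsHomogeneous 4 :=
    (smul h4 ((hsq 0).mul (hsq 1))).add (((hsq 2).add (hsq 3)).pow 2)
  have h4U := smul h4 hU
  have h4V := smul h4 hV
  have h2IT := smul h2I hT
  fin_cases k
  · change (Dprod 1).IsHomogeneous 12
    rw [Dprod_1_eq]
    exact (hU.mul hV).mul hT
  · change (Dprod 2).IsHomogeneous 12
    rw [Dprod_2_eq]
    exact (hU.mul ((hC.add h2IT).add h4V)).mul ((hC.sub h2IT).sub h4V)
  · change (Dprod 4).IsHomogeneous 12
    rw [Dprod_4_eq]
    exact (hV.mul ((hA.sub h2IT).sub h4U)).mul ((hA.add h2IT).add h4U)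
  · change (Dprod 6).IsHomogeneous 12
    rw [Dprod_6_eq]
    exact (hT.mul (((hA.sub hC).sub h4V).add h4U)).mul
      (((hA.sub hC).add h4V).sub h4U)
  · change (Dprod 8).IsHomogeneous 12
    rw [Dprod_8_eq]
    exact (((hA.add h2IT).sub h4U).mul (((hA.sub hC).add h4V).add h4U)).mul
      ((hC.sub h2IT).add h4V)

end

/-- The fifteen products of twelve reflection hyperplanes (one for each block) are
homogeneous of degree 12 and span a subspace of dimension exactly 5 of the space of
homogeneous degree-12 polynomials; moreover the first of them is
`a1·a2·a3·a4·(a1⁴-a2⁴)·(a3⁴-a4⁴)`. -/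
theorem blocks_span_dimension_five :
    (∀ i ∈ Finset.Icc 1 15, Dprod i ∈ MvPolynomial.homogeneousSubmodule (Fin 4) ℂ 12) ∧
    Module.finrank ℂ ↥(Submodule.span ℂ (Dprod '' (Set.Icc 1 15))) = 5 ∧
    Dprod 1 = MvPolynomial.X 0 * MvPolynomial.X 1 * MvPolynomial.X 2 * MvPolynomial.X 3 *
      (MvPolynomial.X 0 ^ 4 - MvPolynomial.X 1 ^ 4) *
      (MvPolynomial.X 2 ^ 4 - MvPolynomial.X 3 ^ 4) := by
  refine ⟨fun i hi =>
    Dprod_mem_of_basisProd_mem basisProd_isHomogeneous (Finset.mem_Icc.mp hi),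
    finrank_span_Dprod, ?_⟩
  rw [Dprod_1_eq, formU, formV, formT]
  ring
end

section
/- There are exactly six 5-element families of blocks among D1,...,D15 whose members are pairwise disjoint subsets of {1,...,60} with union equal to all of {1,...,60} (i.e., which partition the sixty reflection hyperplanes), namely the six pentads P1={D1,D8,D11,D13,D14}, P2={D1,D9,D10,D12,D15}, P3={D2,D4,D6,D8,D15}, P4={D2,D5,D7,D9,D14}, P5={D3,D4,D7,D10,D13}, P6={D3,D5,D6,D11,D12}. -/
/-- If pairwise disjoint blocks indexed by `S` cover the point `k`, and `i`, `j`, `l` are the only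
blocks through `k`, then exactly one of them is indexed by `S`. -/
theorem exactly_one_mem_of_disjoint_cover {S : Finset ℕ} (hS : S ⊆ Finset.Icc 1 15)
    (hd : ∀ i ∈ S, ∀ j ∈ S, i ≠ j → Disjoint (Dblock i) (Dblock j)) {k i j l : ℕ}
    (hk : k ∈ S.biUnion Dblock) (hij : i ≠ j) (hil : i ≠ l) (hjl : j ≠ l)
    (h : (Finset.Icc 1 15).filter (fun m => k ∈ Dblock m) = {i, j, l}) :
    (i ∈ S ∧ j ∉ S ∧ l ∉ S) ∨ (i ∉ S ∧ j ∈ S ∧ l ∉ S) ∨ (i ∉ S ∧ j ∉ S ∧ l ∈ S) := by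
  have through (m : ℕ) (hm : m = i ∨ m = j ∨ m = l) : k ∈ Dblock m := by
    have : m ∈ (Finset.Icc 1 15).filter (fun m => k ∈ Dblock m) := by simpa [h] using hm
    exact (Finset.mem_filter.1 this).2
  have unique (m n : ℕ) (hm : m ∈ S) (hn : n ∈ S) (km : k ∈ Dblock m) (kn : k ∈ Dblock n) :
      m = n := by
    by_contra hne
    exact Finset.disjoint_left.1 (hd m hm n hn hne) km kn
  obtain ⟨m, hm, km⟩ := Finset.mem_biUnion.1 hk
  have hmem : m = i ∨ m = j ∨ m = l := by
    have : m ∈ (Finset.Icc 1 15).filter (fun m => k ∈ Dblock m) :=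
      Finset.mem_filter.2 ⟨hS hm, km⟩
    simpa [h] using this
  have ki := through i (by simp)
  have kj := through j (by simp)
  have kl := through l (by simp)
  grind

/-- There are exactly six ways of choosing five of the fifteen blocks so that they are
pairwise disjoint and cover all sixty reflection hyperplanes: the six pentads
`P₁ = {D₁,D₈,D₁₁,D₁₃,D₁₄}`, …, `P₆ = {D₃,D₅,D₆,D₁₁,D₁₂}` (given by their index sets). -/
theorem six_pentads :
    {S : Finset ℕ | S ⊆ Finset.Icc 1 15 ∧ S.card = 5 ∧
        (∀ i ∈ S, ∀ j ∈ S, i ≠ j → Disjoint (Dblock i) (Dblock j)) ∧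
        S.biUnion Dblock = Finset.Icc 1 60} =
      {({1,8,11,13,14} : Finset ℕ), ({1,9,10,12,15} : Finset ℕ), ({2,4,6,8,15} : Finset ℕ),
        ({2,5,7,9,14} : Finset ℕ), ({3,4,7,10,13} : Finset ℕ), ({3,5,6,11,12} : Finset ℕ)} := by
  ext S
  simp only [Set.mem_ofPred_eq, Set.mem_insert_iff, Set.mem_singleton_iff]
  constructor
  · rintro ⟨hS, hcard, hd, hcover⟩
    have point (k i j l : ℕ) (h : k ∈ Finset.Icc 1 60 ∧ i ≠ j ∧ i ≠ l ∧ j ≠ l ∧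
        (Finset.Icc 1 15).filter (fun m => k ∈ Dblock m) = {i, j, l}) :=
      exactly_one_mem_of_disjoint_cover hS hd (hcover ▸ h.1) h.2.1 h.2.2.1 h.2.2.2.1 h.2.2.2.2
    have h1 := point 1 1 2 3 (by decide)
    have h3 := point 3 1 4 5 (by decide)
    have h5 := point 5 1 6 7 (by decide)
    have h45 := point 45 2 12 13 (by decide)
    have h48 := point 48 2 10 11 (by decide)
    have h46 := point 46 3 14 15 (by decide)
    have h47 := point 47 3 8 9 (by decide)
    have h13 := point 13 4 12 14 (by decide)
    have h14 := point 14 4 9 11 (by decide)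
    have h17 := point 17 5 13 15 (by decide)
    have h18 := point 18 5 8 10 (by decide)
    have h29 := point 29 6 10 14 (by decide)
    have h33 := point 33 6 9 13 (by decide)
    have h30 := point 30 7 11 15 (by decide)
    have h31 := point 31 7 8 12 (by decide)
    have eq_of_subset (T : Finset ℕ) (hT : T.card = 5) (hTS : T ⊆ S) : S = T :=
      (Finset.eq_of_subset_of_card_le hTS (by omega)).symm
    have key : (1 ∈ S ∧ 8 ∈ S ∧ 11 ∈ S ∧ 13 ∈ S ∧ 14 ∈ S) ∨
        (1 ∈ S ∧ 9 ∈ S ∧ 10 ∈ S ∧ 12 ∈ S ∧ 15 ∈ S) ∨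
        (2 ∈ S ∧ 4 ∈ S ∧ 6 ∈ S ∧ 8 ∈ S ∧ 15 ∈ S) ∨
        (2 ∈ S ∧ 5 ∈ S ∧ 7 ∈ S ∧ 9 ∈ S ∧ 14 ∈ S) ∨
        (3 ∈ S ∧ 4 ∈ S ∧ 7 ∈ S ∧ 10 ∈ S ∧ 13 ∈ S) ∨
        (3 ∈ S ∧ 5 ∈ S ∧ 6 ∈ S ∧ 11 ∈ S ∧ 12 ∈ S) := by
      clear point eq_of_subset hcover hd hcard hS
      rcases h1 with h | h | h <;> rcases h47 with hb | hb | hb <;>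
        rcases h3 with hc | hc | hc <;> grind
    refine key.imp ?_ (Or.imp ?_ (Or.imp ?_ (Or.imp ?_ (Or.imp ?_ ?_)))) <;> intro h <;>
      exact eq_of_subset _ (by decide) (by simpa [Finset.insert_subset_iff] using h)
  · rintro (rfl | rfl | rfl | rfl | rfl | rfl) <;> decide
end

section
/- There are exactly six partitions of the index set {1,...,15} of the blocks into five 3-element classes such that no class contains two indices i, j for which D_i and D_j lie in a common pentad (the quintets, analogues of the classical totals of synthemes), namely: {{1,2,3},{4,12,14},{5,8,10},{6,9,13},{7,11,15}}; {{1,2,3},{4,9,11},{5,13,15},{6,10,14},{7,8,12}}; {{1,4,5},{2,12,13},{3,8,9},{6,10,14},{7,11,15}}; {{1,4,5},{2,10,11},{3,14,15},{6,9,13},{7,8,12}}; {{1,6,7},{2,12,13},{3,14,15},{4,9,11},{5,8,10}}; {{1,6,7},{2,10,11},{3,8,9},{4,12,14},{5,13,15}}. -/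
/-- The six pentads, given by the sets of indices of the five blocks they consist of. -/
def Pent : ℕ → Finset ℕ
  | 1 => {1,8,11,13,14}
  | 2 => {1,9,10,12,15}
  | 3 => {2,4,6,8,15}
  | 4 => {2,5,7,9,14}
  | 5 => {3,4,7,10,13}
  | 6 => {3,5,6,11,12}
  | _ => ∅

/-- The fifteen triples of blocks no two of which lie in a common pentad. -/
def quintetClasses : Finset (Finset ℕ) :=
  {{1,2,3}, {1,4,5}, {1,6,7}, {2,10,11}, {2,12,13}, {3,8,9}, {3,14,15}, {4,9,11}, {4,12,14},
    {5,8,10}, {5,13,15}, {6,9,13}, {6,10,14}, {7,8,12}, {7,11,15}}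

theorem mem_quintetClasses_of_pentad_free {c : Finset ℕ} (hsub : c ⊆ Finset.Icc 1 15)
    (hcard : c.card = 3)
    (hfree : ∀ i ∈ c, ∀ j ∈ c, i ≠ j → ¬ ∃ k ∈ Finset.Icc 1 6, i ∈ Pent k ∧ j ∈ Pent k) :
    c ∈ quintetClasses := by
  have key : ∀ c ∈ (Finset.Icc 1 15).powersetCard 3,
      (∀ i ∈ c, ∀ j ∈ c, i ≠ j → ¬ ∃ k ∈ Finset.Icc 1 6, i ∈ Pent k ∧ j ∈ Pent k) →
        c ∈ quintetClasses := by
    decide +kernel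
  exact key c (Finset.mem_powersetCard.2 ⟨hsub, hcard⟩) hfree

/-- The six quintets. -/
def quintets : Finset (Finset (Finset ℕ)) :=
  {{{1,2,3},{4,12,14},{5,8,10},{6,9,13},{7,11,15}},
    {{1,2,3},{4,9,11},{5,13,15},{6,10,14},{7,8,12}},
    {{1,4,5},{2,12,13},{3,8,9},{6,10,14},{7,11,15}},
    {{1,4,5},{2,10,11},{3,14,15},{6,9,13},{7,8,12}},
    {{1,6,7},{2,12,13},{3,14,15},{4,9,11},{5,8,10}},
    {{1,6,7},{2,10,11},{3,8,9},{4,12,14},{5,13,15}}}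

theorem insert_mem_quintets_of_cover : ∀ a ∈ quintetClasses, 1 ∈ a →
    ∀ D ∈ (quintetClasses.filter (Disjoint a ·)).powersetCard 4,
      (∀ n ∈ Finset.Icc 1 15, n ∈ a ∨ ∃ c ∈ D, n ∈ c) → insert a D ∈ quintets := by
  decide +kernel

/-- There are exactly six partitions of the index set `{1, …, 15}` of the blocks into five
3-element classes such that no class contains two indices lying in a common pentad: the six
quintets (analogues of the classical totals of synthemes). -/
theorem six_quintets :
    {C : Finset (Finset ℕ) | C.card = 5 ∧ (∀ c ∈ C, c.card = 3) ∧
        (∀ c ∈ C, ∀ c' ∈ C, c ≠ c' → Disjoint c c') ∧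
        C.biUnion id = Finset.Icc 1 15 ∧
        (∀ c ∈ C, ∀ i ∈ c, ∀ j ∈ c, i ≠ j →
          ¬ ∃ k ∈ Finset.Icc 1 6, i ∈ Pent k ∧ j ∈ Pent k)} =
      {({{1,2,3},{4,12,14},{5,8,10},{6,9,13},{7,11,15}} : Finset (Finset ℕ)),
       ({{1,2,3},{4,9,11},{5,13,15},{6,10,14},{7,8,12}} : Finset (Finset ℕ)),
       ({{1,4,5},{2,12,13},{3,8,9},{6,10,14},{7,11,15}} : Finset (Finset ℕ)),
       ({{1,4,5},{2,10,11},{3,14,15},{6,9,13},{7,8,12}} : Finset (Finset ℕ)),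
       ({{1,6,7},{2,12,13},{3,14,15},{4,9,11},{5,8,10}} : Finset (Finset ℕ)),
       ({{1,6,7},{2,10,11},{3,8,9},{4,12,14},{5,13,15}} : Finset (Finset ℕ))} := by
  ext C
  constructor
  · rintro ⟨hcard, hthree, hdisj, hunion, hfree⟩
    have hclass : C ⊆ quintetClasses := fun c hc =>
      mem_quintetClasses_of_pentad_free
        (hunion ▸ Finset.subset_biUnion_of_mem id hc) (hthree c hc) (hfree c hc)
    have hcover : ∀ n ∈ Finset.Icc 1 15, ∃ c ∈ C, n ∈ c := fun n hn =>
      Finset.mem_biUnion.1 (hunion ▸ hn)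
    obtain ⟨a, ha, h1a⟩ := hcover 1 (by decide)
    have hsub : C.erase a ⊆ quintetClasses.filter (Disjoint a ·) := fun c hc =>
      have hcC := Finset.mem_of_mem_erase hc
      Finset.mem_filter.2 ⟨hclass hcC, hdisj a ha c hcC (Finset.ne_of_mem_erase hc).symm⟩
    have hC : insert a (C.erase a) ∈ quintets :=
      insert_mem_quintets_of_cover a (hclass ha) h1a _
        (Finset.mem_powersetCard.2 ⟨hsub, by rw [Finset.card_erase_of_mem ha, hcard]⟩) fun n hn => by
          obtain ⟨c, hc, hnc⟩ := hcover n hn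
          by_cases hca : c = a
          · exact Or.inl (hca ▸ hnc)
          · exact Or.inr ⟨c, Finset.mem_erase.2 ⟨hca, hc⟩, hnc⟩
    rw [Finset.insert_erase ha] at hC
    simpa only [quintets, Finset.mem_insert, Finset.mem_singleton, Set.mem_insert_iff,
      Set.mem_singleton_iff] using hC
  · rintro (rfl | rfl | rfl | rfl | rfl | rfl) <;>
      exact ⟨by decide +kernel, by decide +kernel, by decide +kernel, by decide +kernel,
        by decide +kernel⟩
end

section
/- Let F be the subgroup of GL(4,C) generated by the five matrices g1,...,g5. Then each g_k has order 2, the product g1*g2*g3*g4 equals i times the identity matrix, the cyclic subgroup Z generated by i*Id is central in F of order 4, the quotient group F/Z is elementary abelian of order 16 (isomorphic to (Z/2)^4), and F has order 64; in particular F is a Heisenberg-type central extension 1 -> Z/4 -> F -> (Z/2)^4 -> 1. -/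
open Matrix

noncomputable section

/-- The five generators `g₁, …, g₅` of the Heisenberg-type group `F ⊆ GL(4, ℂ)`. -/
def g1 : Matrix (Fin 4) (Fin 4) ℂ :=
  !![1, 0, 0, 0; 0, 1, 0, 0; 0, 0, -1, 0; 0, 0, 0, -1]

def g2 : Matrix (Fin 4) (Fin 4) ℂ :=
  !![0, Complex.I, 0, 0; -Complex.I, 0, 0, 0; 0, 0, 1, 0; 0, 0, 0, -1]

def g3 : Matrix (Fin 4) (Fin 4) ℂ :=
  !![1, 0, 0, 0; 0, -1, 0, 0; 0, 0, 0, Complex.I; 0, 0, -Complex.I, 0]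

def g4 : Matrix (Fin 4) (Fin 4) ℂ :=
  !![0, -1, 0, 0; -1, 0, 0, 0; 0, 0, 0, -1; 0, 0, -1, 0]

def g5 : Matrix (Fin 4) (Fin 4) ℂ :=
  (1/2 : ℂ) •
    !![0, 0, 1 + Complex.I, 1 - Complex.I;
       0, 0, 1 - Complex.I, 1 + Complex.I;
       1 - Complex.I, 1 + Complex.I, 0, 0;
       1 + Complex.I, 1 - Complex.I, 0, 0]

/-- The subgroup `F` of `GL(4, ℂ)` generated by the five matrices `g₁, …, g₅`. -/
def Fgrp : Subgroup (Matrix (Fin 4) (Fin 4) ℂ)ˣ :=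
  Subgroup.closure {x | (x : Matrix (Fin 4) (Fin 4) ℂ) = g1 ∨
    (x : Matrix (Fin 4) (Fin 4) ℂ) = g2 ∨ (x : Matrix (Fin 4) (Fin 4) ℂ) = g3 ∨
    (x : Matrix (Fin 4) (Fin 4) ℂ) = g4 ∨ (x : Matrix (Fin 4) (Fin 4) ℂ) = g5}

/-- The cyclic subgroup `Z` of `GL(4, ℂ)` generated by `i·Id`. -/
def Zgrp : Subgroup (Matrix (Fin 4) (Fin 4) ℂ)ˣ :=
  Subgroup.closure
    {x | (x : Matrix (Fin 4) (Fin 4) ℂ) = Complex.I • (1 : Matrix (Fin 4) (Fin 4) ℂ)}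

/-- Conjugation by any element of the closure of `S` fixes `u` up to sign as soon as this holds
for the elements of `S`. -/
theorem semiconjBy_self_or_neg_of_mem_closure {R : Type*} [Ring R] {u : Rˣ} {S : Set Rˣ}
    (hS : ∀ x ∈ S, SemiconjBy x u u ∨ SemiconjBy x u (-u)) {x : Rˣ}
    (hx : x ∈ Subgroup.closure S) : SemiconjBy x u u ∨ SemiconjBy x u (-u) := by
  induction hx using Subgroup.closure_induction with
  | mem x hx => exact hS x hx
  | one => exact .inl (SemiconjBy.one_left u)
  | mul x y _ _ ihx ihy =>
    rcases ihx with hx | hx <;> rcases ihy with hy | hy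
    · exact .inl (hx.mul_left hy)
    · exact .inr (hx.neg_right.mul_left hy)
    · exact .inr (hx.mul_left hy)
    · exact .inl (by simpa using hx.neg_right.mul_left hy)
  | inv x _ ih =>
    rcases ih with hx | hx
    · exact .inl hx.inv_symm_left
    · exact .inr (by simpa using hx.inv_symm_left.neg_right)

theorem SemiconjBy.not_neg_right {R : Type*} [Ring R] [NeZero (2 : R)] {x u : Rˣ}
    (h : SemiconjBy x u u) : ¬ SemiconjBy x u (-u) := by
  intro h'
  have h1 : u = -u := mul_right_cancel (h.eq.symm.trans h'.eq)
  have h2 : (u : R) = -u := by simpa using congrArg Units.val h1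
  have h3 : (2 : R) * u = 0 := by rw [two_mul, ← sub_neg_eq_add, ← h2, sub_self]
  exact two_ne_zero ((Units.mul_left_eq_zero u).1 h3)

open Classical in
/-- If conjugation by the elements of `H` fixes `u` up to sign, this is the homomorphism
recording the sign. -/
def conjSign {R : Type*} [Ring R] [NeZero (2 : R)] (u : Rˣ) (H : Subgroup Rˣ)
    (h : ∀ x ∈ H, SemiconjBy x u u ∨ SemiconjBy x u (-u)) : H →* Multiplicative (ZMod 2) :=
  MonoidHom.mk' (fun x => if SemiconjBy (x : Rˣ) u u then 1 else Multiplicative.ofAdd 1) <| by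
    intro x y
    have key : Multiplicative.ofAdd (1 : ZMod 2) * Multiplicative.ofAdd 1 = 1 := by decide
    rcases h x x.2 with hx | hx <;> rcases h y y.2 with hy | hy
    · simp [hx, hy, hx.mul_left hy]
    · have hxy := hx.neg_right.mul_left hy
      have h1 : ¬ SemiconjBy ((x : Rˣ) * y) u u := fun h => h.not_neg_right hxy
      have h2 : ¬ SemiconjBy (y : Rˣ) u u := fun h => h.not_neg_right hy
      simp [hx, h1, h2]
    · have hxy := hx.mul_left hy
      have h1 : ¬ SemiconjBy ((x : Rˣ) * y) u u := fun h => h.not_neg_right hxy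
      have h2 : ¬ SemiconjBy (x : Rˣ) u u := fun h => h.not_neg_right hx
      simp [hy, h1, h2]
    · have hxy : SemiconjBy ((x : Rˣ) * y) u u := by simpa using hx.neg_right.mul_left hy
      have h1 : ¬ SemiconjBy (x : Rˣ) u u := fun h => h.not_neg_right hx
      have h2 : ¬ SemiconjBy (y : Rˣ) u u := fun h => h.not_neg_right hy
      simp [hxy, h1, h2, key]

section conjSign

variable {R : Type*} [Ring R] [NeZero (2 : R)] {u : Rˣ} {H : Subgroup Rˣ}
  {h : ∀ x ∈ H, SemiconjBy x u u ∨ SemiconjBy x u (-u)} {x : H}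

theorem conjSign_eq_one_iff : conjSign u H h x = 1 ↔ SemiconjBy (x : Rˣ) u u := by
  simp only [conjSign, MonoidHom.mk'_apply]
  split_ifs with hx
  · simp [hx]
  · simp [hx]

theorem conjSign_of_semiconjBy_neg (hx : SemiconjBy (x : Rˣ) u (-u)) :
    conjSign u H h x = Multiplicative.ofAdd 1 := by
  have h' : ¬ SemiconjBy (x : Rˣ) u u := fun h => h.not_neg_right hx
  simp [conjSign, h']

end conjSign

theorem g1_mul_self : g1 * g1 = 1 := by
  ext i j; fin_cases i <;> fin_cases j <;> simp [g1, Matrix.mul_apply, Fin.sum_univ_four]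

theorem g2_mul_self : g2 * g2 = 1 := by
  ext i j; fin_cases i <;> fin_cases j <;> simp [g2, Matrix.mul_apply, Fin.sum_univ_four]

theorem g3_mul_self : g3 * g3 = 1 := by
  ext i j; fin_cases i <;> fin_cases j <;> simp [g3, Matrix.mul_apply, Fin.sum_univ_four]

theorem g4_mul_self : g4 * g4 = 1 := by
  ext i j; fin_cases i <;> fin_cases j <;> simp [g4, Matrix.mul_apply, Fin.sum_univ_four]

theorem g5_mul_self : g5 * g5 = 1 := by
  ext i j
  fin_cases i <;> fin_cases j <;> simp [g5, Matrix.mul_apply, Fin.sum_univ_four] <;>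
    grind [Complex.I_mul_I]

theorem g1_g2_comm : g1 * g2 = g2 * g1 := by
  ext i j
  fin_cases i <;> fin_cases j <;> simp [g1, g2, Matrix.mul_apply, Fin.sum_univ_four]

theorem g1_g3_comm : g1 * g3 = g3 * g1 := by
  ext i j
  fin_cases i <;> fin_cases j <;> simp [g1, g3, Matrix.mul_apply, Fin.sum_univ_four]

theorem g1_g4_comm : g1 * g4 = g4 * g1 := by
  ext i j
  fin_cases i <;> fin_cases j <;> simp [g1, g4, Matrix.mul_apply, Fin.sum_univ_four]

theorem g1_g5_anticomm : g1 * g5 = -(g5 * g1) := by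
  ext i j
  fin_cases i <;> fin_cases j <;> simp [g1, g5, Matrix.mul_apply, Fin.sum_univ_four]

theorem g2_g3_anticomm : g2 * g3 = -(g3 * g2) := by
  ext i j
  fin_cases i <;> fin_cases j <;> simp [g2, g3, Matrix.mul_apply, Fin.sum_univ_four]

theorem g2_g4_anticomm : g2 * g4 = -(g4 * g2) := by
  ext i j
  fin_cases i <;> fin_cases j <;> simp [g2, g4, Matrix.mul_apply, Fin.sum_univ_four]

theorem g3_g4_anticomm : g3 * g4 = -(g4 * g3) := by
  ext i j
  fin_cases i <;> fin_cases j <;> simp [g3, g4, Matrix.mul_apply, Fin.sum_univ_four]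

theorem g2_g5_comm : g2 * g5 = g5 * g2 := by
  ext i j
  fin_cases i <;> fin_cases j <;> simp [g2, g5, Matrix.mul_apply, Fin.sum_univ_four] <;>
    grind [Complex.I_mul_I]

theorem g3_g5_anticomm : g3 * g5 = -(g5 * g3) := by
  ext i j
  fin_cases i <;> fin_cases j <;> simp [g3, g5, Matrix.mul_apply, Fin.sum_univ_four] <;>
    grind [Complex.I_mul_I]

theorem g4_g5_comm : g4 * g5 = g5 * g4 := by
  ext i j
  fin_cases i <;> fin_cases j <;> simp [g4, g5, Matrix.mul_apply, Fin.sum_univ_four]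

theorem g1_mul_g2_mul_g3_mul_g4 :
    g1 * g2 * g3 * g4 = Complex.I • (1 : Matrix (Fin 4) (Fin 4) ℂ) := by
  ext i j
  fin_cases i <;> fin_cases j <;> simp [g1, g2, g3, g4, Matrix.mul_apply, Fin.sum_univ_four]

theorem det_g1 : g1.det = 1 := by simp [g1, Matrix.det_succ_row_zero, Fin.sum_univ_succ]

theorem det_g2 : g2.det = 1 := by
  simp [g2, Matrix.det_succ_row_zero, Fin.sum_univ_succ, Fin.succAbove]

theorem det_g3 : g3.det = 1 := by
  simp [g3, Matrix.det_succ_row_zero, Fin.sum_univ_succ, Fin.succAbove]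

theorem det_g4 : g4.det = 1 := by
  simp [g4, Matrix.det_succ_row_zero, Fin.sum_univ_succ, Fin.succAbove]

theorem det_g5 : g5.det = 1 := by
  simp [g5, Matrix.det_succ_row_zero, Fin.sum_univ_succ, Fin.succAbove]
  grind [Complex.I_mul_I]

/-- The matrices `g1`, `g2`, `g3`, `g5` act irreducibly: their commutant is scalar. -/
theorem eq_smul_one_of_commute {m : Matrix (Fin 4) (Fin 4) ℂ} (h1 : m * g1 = g1 * m)
    (h2 : m * g2 = g2 * m) (h3 : m * g3 = g3 * m) (h5 : m * g5 = g5 * m) :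
    m = m 0 0 • (1 : Matrix (Fin 4) (Fin 4) ℂ) := by
  have e1 := fun i j => congrFun (congrFun h1 i) j
  have e2 := fun i j => congrFun (congrFun h2 i) j
  have e3 := fun i j => congrFun (congrFun h3 i) j
  have e5 := congrFun (congrFun h5 0) 2
  have e5' := congrFun (congrFun h5 0) 3
  simp [g1, g2, g3, g5, Matrix.mul_apply, Fin.sum_univ_four, Fin.forall_fin_succ]
    at e1 e2 e3 e5 e5'
  ext i j
  fin_cases i <;> fin_cases j <;> simp
  all_goals grind [Complex.I_ne_zero]

/-- An involution as a unit. -/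
def unitOfMulSelf {R : Type*} [Monoid R] (g : R) (h : g * g = 1) : Rˣ := ⟨g, g, h, h⟩

def u1 : (Matrix (Fin 4) (Fin 4) ℂ)ˣ := unitOfMulSelf g1 g1_mul_self

def u2 : (Matrix (Fin 4) (Fin 4) ℂ)ˣ := unitOfMulSelf g2 g2_mul_self

def u3 : (Matrix (Fin 4) (Fin 4) ℂ)ˣ := unitOfMulSelf g3 g3_mul_self

def u4 : (Matrix (Fin 4) (Fin 4) ℂ)ˣ := unitOfMulSelf g4 g4_mul_self

def u5 : (Matrix (Fin 4) (Fin 4) ℂ)ˣ := unitOfMulSelf g5 g5_mul_self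

theorem Fgrp_eq_closure : Fgrp = Subgroup.closure {u1, u2, u3, u4, u5} := by
  unfold Fgrp
  congr 1
  ext x
  simp only [Set.mem_ofPred_eq, Set.mem_insert_iff, Set.mem_singleton_iff, Units.ext_iff]
  rfl

theorem u1_mem : u1 ∈ Fgrp := Subgroup.subset_closure (.inl rfl)

theorem u2_mem : u2 ∈ Fgrp := Subgroup.subset_closure (.inr (.inl rfl))

theorem u3_mem : u3 ∈ Fgrp := Subgroup.subset_closure (.inr (.inr (.inl rfl)))

theorem u4_mem : u4 ∈ Fgrp := Subgroup.subset_closure (.inr (.inr (.inr (.inl rfl))))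

theorem u5_mem : u5 ∈ Fgrp := Subgroup.subset_closure (.inr (.inr (.inr (.inr rfl))))

/-- The scalar matrix `i·Id` as a unit. -/
def uI : (Matrix (Fin 4) (Fin 4) ℂ)ˣ where
  val := Complex.I • 1
  inv := -Complex.I • 1
  val_inv := by simp [smul_smul]
  inv_val := by simp [smul_smul]

theorem Zgrp_eq_zpowers : Zgrp = Subgroup.zpowers uI := by
  rw [Subgroup.zpowers_eq_closure]
  unfold Zgrp
  congr 1
  ext x
  simp only [Set.mem_ofPred_eq, Set.mem_singleton_iff, Units.ext_iff]
  rfl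

theorem uI_mem_Fgrp : uI ∈ Fgrp := by
  have h : uI = u1 * u2 * u3 * u4 := Units.ext g1_mul_g2_mul_g3_mul_g4.symm
  rw [h]
  exact mul_mem (mul_mem (mul_mem u1_mem u2_mem) u3_mem) u4_mem

theorem uI_commute (x : (Matrix (Fin 4) (Fin 4) ℂ)ˣ) : Commute uI x := by
  refine Units.ext ?_
  simp [uI]

theorem orderOf_uI : orderOf uI = 4 := by
  have : Fact (Nat.Prime 2) := ⟨Nat.prime_two⟩
  refine orderOf_eq_prime_pow (p := 2) (n := 1) (fun h => ?_) (Units.ext ?_)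
  · have h' : (Complex.I • (1 : Matrix (Fin 4) (Fin 4) ℂ)) ^ 2 ^ 1 = 1 := congrArg Units.val h
    have h0 := congrFun (congrFun h' 0) 0
    norm_num [smul_pow, Complex.ext_iff] at h0
  · simp [uI, smul_pow]

theorem mem_Zgrp_of_eq_smul_one {x : (Matrix (Fin 4) (Fin 4) ℂ)ˣ} {c : ℂ}
    (hx : (x : Matrix (Fin 4) (Fin 4) ℂ) = c • 1) (hc : c ^ 4 = 1) : x ∈ Zgrp := by
  obtain ⟨n, hn⟩ : ∃ n : ℕ, c = Complex.I ^ n := by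
    have h : (c - 1) * (c + 1) * ((c - Complex.I) * (c + Complex.I)) = 0 := by
      linear_combination hc - (c ^ 2 - 1) * Complex.I_sq
    rcases mul_eq_zero.1 h with h | h <;> rcases mul_eq_zero.1 h with h | h
    · exact ⟨0, by linear_combination h⟩
    · exact ⟨2, by linear_combination h - Complex.I_sq⟩
    · exact ⟨1, by linear_combination h⟩
    · exact ⟨3, by linear_combination h - Complex.I * Complex.I_sq⟩
  rw [Zgrp_eq_zpowers]
  have h : x = uI ^ n := Units.ext (by simp [hx, hn, uI, smul_pow])
  exact h ▸ pow_mem (Subgroup.mem_zpowers uI) n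

theorem det_eq_one_of_mem_Fgrp {x : (Matrix (Fin 4) (Fin 4) ℂ)ˣ} (hx : x ∈ Fgrp) :
    (x : Matrix (Fin 4) (Fin 4) ℂ).det = 1 := by
  unfold Fgrp at hx
  induction hx using Subgroup.closure_induction with
  | mem x hx =>
    rcases hx with h | h | h | h | h <;> simp [h, det_g1, det_g2, det_g3, det_g4, det_g5]
  | one => simp
  | mul x y _ _ ihx ihy => simp [ihx, ihy]
  | inv x _ ih =>
    have h := congrArg Matrix.det x.inv_mul
    rwa [Matrix.det_mul, ih, mul_one, Matrix.det_one] at h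

theorem semiconjBy_u1_u2 : SemiconjBy u1 u2 u2 := Units.ext g1_g2_comm

theorem semiconjBy_u1_u3 : SemiconjBy u1 u3 u3 := Units.ext g1_g3_comm

theorem semiconjBy_u1_u4 : SemiconjBy u1 u4 u4 := Units.ext g1_g4_comm

theorem semiconjBy_u1_u5 : SemiconjBy u1 u5 (-u5) :=
  Units.ext (g1_g5_anticomm.trans (neg_mul g5 g1).symm)

theorem semiconjBy_u2_u3 : SemiconjBy u2 u3 (-u3) :=
  Units.ext (g2_g3_anticomm.trans (neg_mul g3 g2).symm)

theorem semiconjBy_u2_u4 : SemiconjBy u2 u4 (-u4) :=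
  Units.ext (g2_g4_anticomm.trans (neg_mul g4 g2).symm)

theorem semiconjBy_u3_u4 : SemiconjBy u3 u4 (-u4) :=
  Units.ext (g3_g4_anticomm.trans (neg_mul g4 g3).symm)

theorem semiconjBy_u2_u5 : SemiconjBy u2 u5 u5 := Units.ext g2_g5_comm

theorem semiconjBy_u3_u5 : SemiconjBy u3 u5 (-u5) :=
  Units.ext (g3_g5_anticomm.trans (neg_mul g5 g3).symm)

theorem semiconjBy_u4_u5 : SemiconjBy u4 u5 u5 := Units.ext g4_g5_comm

theorem SemiconjBy.swap_neg {R : Type*} [Ring R] {x u : Rˣ} (h : SemiconjBy x u (-u)) :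
    SemiconjBy u x (-x) := by
  have h' : x * u = -u * x := h
  simp only [SemiconjBy, neg_mul, h', neg_neg]

theorem SemiconjBy.swap_self {R : Type*} [Ring R] {x u : Rˣ} (h : SemiconjBy x u u) :
    SemiconjBy u x x := h.eq.symm

theorem conj_u1_of_mem_Fgrp (x : (Matrix (Fin 4) (Fin 4) ℂ)ˣ) (hx : x ∈ Fgrp) :
    SemiconjBy x u1 u1 ∨ SemiconjBy x u1 (-u1) := by
  refine semiconjBy_self_or_neg_of_mem_closure ?_ (Fgrp_eq_closure ▸ hx)
  rintro x (rfl | rfl | rfl | rfl | rfl)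
  · exact .inl (Commute.refl _)
  · exact .inl semiconjBy_u1_u2.swap_self
  · exact .inl semiconjBy_u1_u3.swap_self
  · exact .inl semiconjBy_u1_u4.swap_self
  · exact .inr semiconjBy_u1_u5.swap_neg

theorem conj_u2_of_mem_Fgrp (x : (Matrix (Fin 4) (Fin 4) ℂ)ˣ) (hx : x ∈ Fgrp) :
    SemiconjBy x u2 u2 ∨ SemiconjBy x u2 (-u2) := by
  refine semiconjBy_self_or_neg_of_mem_closure ?_ (Fgrp_eq_closure ▸ hx)
  rintro x (rfl | rfl | rfl | rfl | rfl)
  · exact .inl semiconjBy_u1_u2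
  · exact .inl (Commute.refl _)
  · exact .inr semiconjBy_u2_u3.swap_neg
  · exact .inr semiconjBy_u2_u4.swap_neg
  · exact .inl semiconjBy_u2_u5.swap_self

theorem conj_u3_of_mem_Fgrp (x : (Matrix (Fin 4) (Fin 4) ℂ)ˣ) (hx : x ∈ Fgrp) :
    SemiconjBy x u3 u3 ∨ SemiconjBy x u3 (-u3) := by
  refine semiconjBy_self_or_neg_of_mem_closure ?_ (Fgrp_eq_closure ▸ hx)
  rintro x (rfl | rfl | rfl | rfl | rfl)
  · exact .inl semiconjBy_u1_u3
  · exact .inr semiconjBy_u2_u3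
  · exact .inl (Commute.refl _)
  · exact .inr semiconjBy_u3_u4.swap_neg
  · exact .inr semiconjBy_u3_u5.swap_neg

theorem conj_u5_of_mem_Fgrp (x : (Matrix (Fin 4) (Fin 4) ℂ)ˣ) (hx : x ∈ Fgrp) :
    SemiconjBy x u5 u5 ∨ SemiconjBy x u5 (-u5) := by
  refine semiconjBy_self_or_neg_of_mem_closure ?_ (Fgrp_eq_closure ▸ hx)
  rintro x (rfl | rfl | rfl | rfl | rfl)
  · exact .inr semiconjBy_u1_u5
  · exact .inl semiconjBy_u2_u5
  · exact .inr semiconjBy_u3_u5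
  · exact .inl semiconjBy_u4_u5
  · exact .inl (Commute.refl _)

instance : NeZero (2 : Matrix (Fin 4) (Fin 4) ℂ) :=
  ⟨fun h => two_ne_zero (α := ℂ)
    (by simpa [Matrix.ofNat_apply] using congrFun (congrFun h 0) 0)⟩

/-- The signs by which an element of `F` conjugates `g1`, `g2`, `g3` and `g5`. -/
def conjSigns : Fgrp →* (Fin 4 → Multiplicative (ZMod 2)) :=
  MonoidHom.pi ![conjSign u1 Fgrp conj_u1_of_mem_Fgrp, conjSign u2 Fgrp conj_u2_of_mem_Fgrp,
    conjSign u3 Fgrp conj_u3_of_mem_Fgrp, conjSign u5 Fgrp conj_u5_of_mem_Fgrp]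

theorem conjSigns_apply (x : Fgrp) :
    conjSigns x = ![conjSign u1 Fgrp conj_u1_of_mem_Fgrp x, conjSign u2 Fgrp conj_u2_of_mem_Fgrp x,
      conjSign u3 Fgrp conj_u3_of_mem_Fgrp x, conjSign u5 Fgrp conj_u5_of_mem_Fgrp x] := by
  ext i; fin_cases i <;> rfl

theorem vec_four_congr {α : Type*} {a b c d a' b' c' d' : α} (ha : a = a') (hb : b = b')
    (hc : c = c') (hd : d = d') : ![a, b, c, d] = ![a', b', c', d'] := by
  rw [ha, hb, hc, hd]

theorem conjSigns_u1 : conjSigns ⟨u1, u1_mem⟩ =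
    ![1, 1, 1, Multiplicative.ofAdd 1] := by
  rw [conjSigns_apply]
  exact vec_four_congr (conjSign_eq_one_iff.2 (Commute.refl _))
    (conjSign_eq_one_iff.2 semiconjBy_u1_u2)
    (conjSign_eq_one_iff.2 semiconjBy_u1_u3)
    (conjSign_of_semiconjBy_neg semiconjBy_u1_u5)

theorem conjSigns_u2 : conjSigns ⟨u2, u2_mem⟩ =
    ![1, 1, Multiplicative.ofAdd 1, 1] := by
  rw [conjSigns_apply]
  exact vec_four_congr (conjSign_eq_one_iff.2 semiconjBy_u1_u2.swap_self)
    (conjSign_eq_one_iff.2 (Commute.refl _))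
    (conjSign_of_semiconjBy_neg semiconjBy_u2_u3)
    (conjSign_eq_one_iff.2 semiconjBy_u2_u5)

theorem conjSigns_u3 : conjSigns ⟨u3, u3_mem⟩ =
    ![1, Multiplicative.ofAdd 1, 1, Multiplicative.ofAdd 1] := by
  rw [conjSigns_apply]
  exact vec_four_congr (conjSign_eq_one_iff.2 semiconjBy_u1_u3.swap_self)
    (conjSign_of_semiconjBy_neg semiconjBy_u2_u3.swap_neg)
    (conjSign_eq_one_iff.2 (Commute.refl _))
    (conjSign_of_semiconjBy_neg semiconjBy_u3_u5)

theorem conjSigns_u5 : conjSigns ⟨u5, u5_mem⟩ =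
    ![Multiplicative.ofAdd 1, 1, Multiplicative.ofAdd 1, 1] := by
  rw [conjSigns_apply]
  exact vec_four_congr (conjSign_of_semiconjBy_neg semiconjBy_u1_u5.swap_neg)
    (conjSign_eq_one_iff.2 semiconjBy_u2_u5.swap_self)
    (conjSign_of_semiconjBy_neg semiconjBy_u3_u5.swap_neg)
    (conjSign_eq_one_iff.2 (Commute.refl _))

theorem conjSigns_surjective : Function.Surjective conjSigns := by
  intro v
  let x1 : Fgrp := ⟨u1, u1_mem⟩
  let x2 : Fgrp := ⟨u2, u2_mem⟩
  let x3 : Fgrp := ⟨u3, u3_mem⟩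
  let x5 : Fgrp := ⟨u5, u5_mem⟩
  refine ⟨x5 ^ (v 0).toAdd.val * x3 ^ (v 1).toAdd.val * x2 ^ ((v 2).toAdd + (v 0).toAdd).val *
    x1 ^ ((v 3).toAdd + (v 1).toAdd).val, ?_⟩
  simp only [map_mul, map_pow, x1, x2, x3, x5, conjSigns_u1, conjSigns_u2, conjSigns_u3,
    conjSigns_u5]
  revert v
  decide

theorem conjSigns_eq_one_iff (x : Fgrp) :
    conjSigns x = 1 ↔ (x : (Matrix (Fin 4) (Fin 4) ℂ)ˣ) ∈ Zgrp := by
  constructor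
  · intro h
    have hval : ∀ {u : (Matrix (Fin 4) (Fin 4) ℂ)ˣ}, SemiconjBy x.1 u u →
        x.1.val * u.val = u.val * x.1.val :=
      fun h => congrArg Units.val h.eq
    rw [conjSigns_apply] at h
    have hs := eq_smul_one_of_commute
      (hval (conjSign_eq_one_iff.1 (congrFun h 0))) (hval (conjSign_eq_one_iff.1 (congrFun h 1)))
      (hval (conjSign_eq_one_iff.1 (congrFun h 2))) (hval (conjSign_eq_one_iff.1 (congrFun h 3)))
    refine mem_Zgrp_of_eq_smul_one hs ?_
    have hdet := det_eq_one_of_mem_Fgrp x.2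
    rw [hs, Matrix.det_smul, Matrix.det_one, mul_one, Fintype.card_fin] at hdet
    exact hdet
  · intro h
    rw [Zgrp_eq_zpowers] at h
    obtain ⟨n, hn⟩ := h
    have hc : ∀ u, SemiconjBy (x : (Matrix (Fin 4) (Fin 4) ℂ)ˣ) u u :=
      fun u => hn ▸ (uI_commute u).zpow_left n
    rw [conjSigns_apply]
    simp only [conjSign_eq_one_iff.2 (hc _)]
    ext i; fin_cases i <;> rfl

theorem orderOf_eq_two_of_mul_self {R : Type*} [Monoid R] {g : R} (h : g * g = 1) (h1 : g ≠ 1) :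
    orderOf g = 2 :=
  orderOf_eq_prime (by rw [pow_two, h]) h1

/-- The group `F` generated by `g₁, …, g₅` is a Heisenberg-type group of order 64: each `gₖ`
has order 2, `g₁g₂g₃g₄ = i·Id`, the cyclic subgroup `Z` generated by `i·Id` is a central
subgroup of `F` of order 4, and `F/Z` is elementary abelian of order 16, isomorphic to
`(ℤ/2)⁴`; in particular `F` is a central extension `1 → ℤ/4 → F → (ℤ/2)⁴ → 1`. -/
theorem heisenberg_group_F :
    (orderOf g1 = 2 ∧ orderOf g2 = 2 ∧ orderOf g3 = 2 ∧ orderOf g4 = 2 ∧ orderOf g5 = 2) ∧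
    g1 * g2 * g3 * g4 = Complex.I • (1 : Matrix (Fin 4) (Fin 4) ℂ) ∧
    Zgrp ≤ Fgrp ∧
    (∀ z ∈ Zgrp, ∀ x ∈ Fgrp, z * x = x * z) ∧
    Nat.card Zgrp = 4 ∧
    Nat.card Fgrp = 64 ∧
    Nat.card (Fgrp ⧸ Zgrp.subgroupOf Fgrp) = 16 ∧
    (∃ φ : Fgrp →* (Fin 4 → Multiplicative (ZMod 2)),
      Function.Surjective φ ∧ ∀ x : Fgrp, φ x = 1 ↔ (x : (Matrix (Fin 4) (Fin 4) ℂ)ˣ) ∈ Zgrp) := by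
  have hZF : Zgrp ≤ Fgrp := by
    rw [Zgrp_eq_zpowers, Subgroup.zpowers_le]
    exact uI_mem_Fgrp
  have hZ : Nat.card Zgrp = 4 := by rw [Zgrp_eq_zpowers, Nat.card_zpowers, orderOf_uI]
  have hker : conjSigns.ker = Zgrp.subgroupOf Fgrp := by
    ext x
    rw [MonoidHom.mem_ker, conjSigns_eq_one_iff, Subgroup.mem_subgroupOf]
  have hQ : Nat.card (Fgrp ⧸ Zgrp.subgroupOf Fgrp) = 16 := by
    rw [← hker,
      Nat.card_congr
        (QuotientGroup.quotientKerEquivOfSurjective conjSigns conjSigns_surjective).toEquiv,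
      Nat.card_eq_fintype_card]
    rfl
  refine ⟨⟨?_, ?_, ?_, ?_, ?_⟩, g1_mul_g2_mul_g3_mul_g4, hZF, ?_, hZ, ?_, hQ, conjSigns,
    conjSigns_surjective, conjSigns_eq_one_iff⟩
  · refine orderOf_eq_two_of_mul_self g1_mul_self fun h => ?_
    have := congrFun (congrFun h 2) 2
    simp [g1] at this
    norm_num at this
  · refine orderOf_eq_two_of_mul_self g2_mul_self fun h => ?_
    have := congrFun (congrFun h 0) 0
    simp [g2] at this
  · refine orderOf_eq_two_of_mul_self g3_mul_self fun h => ?_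
    have := congrFun (congrFun h 2) 2
    simp [g3] at this
  · refine orderOf_eq_two_of_mul_self g4_mul_self fun h => ?_
    have := congrFun (congrFun h 0) 0
    simp [g4] at this
  · refine orderOf_eq_two_of_mul_self g5_mul_self fun h => ?_
    have := congrFun (congrFun h 0) 0
    simp [g5] at this
  · intro z hz x _
    rw [Zgrp_eq_zpowers] at hz
    obtain ⟨n, rfl⟩ := hz
    exact (uI_commute x).zpow_left n
  · rw [Subgroup.card_eq_card_quotient_mul_card_subgroup (Zgrp.subgroupOf Fgrp), hQ,
      Nat.card_congr (Subgroup.subgroupOfEquivOfLe hZF).toEquiv, hZ]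

end
end

section
/- A homogeneous polynomial P of degree 4 in C[a1,a2,a3,a4] satisfies P(g . a) = P(a) for each of the five matrices g = g1,...,g5 (equivalently, P is invariant under the substitution action of the group F generated by g1,...,g5) if and only if P lies in the C-linear span of the five quartics q0, q1, q2, q3, q4; in particular the space of F-invariant quartic forms has dimension exactly 5. -/
open Matrix

noncomputable section

/-- The action of a matrix `g` on a polynomial `P(a)` by linear substitution of the
variables: `(msub g) P` is the polynomial `a ↦ P(g · a)`. -/
def msub (g : Matrix (Fin 4) (Fin 4) ℂ) (P : MvPolynomial (Fin 4) ℂ) :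
    MvPolynomial (Fin 4) ℂ :=
  MvPolynomial.aeval (fun i => ∑ j, MvPolynomial.C (g i j) * MvPolynomial.X j) P

/-- The quartics `q₀, …, q₄` spanning the space `U₅` of quadratic complexes coming from the
Cartan subspace. -/
def q0 : MvPolynomial (Fin 4) ℂ :=
  (MvPolynomial.X 0 ^ 2 - MvPolynomial.X 1 ^ 2) * (MvPolynomial.X 2 ^ 2 - MvPolynomial.X 3 ^ 2)
def q1 : MvPolynomial (Fin 4) ℂ :=
  (MvPolynomial.X 0 ^ 2 + MvPolynomial.X 1 ^ 2) * MvPolynomial.X 2 * MvPolynomial.X 3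
def q2 : MvPolynomial (Fin 4) ℂ :=
  MvPolynomial.X 0 * MvPolynomial.X 1 * (MvPolynomial.X 2 ^ 2 + MvPolynomial.X 3 ^ 2)
def q3 : MvPolynomial (Fin 4) ℂ :=
  2 * MvPolynomial.X 0 ^ 4 + 2 * MvPolynomial.X 1 ^ 4 - MvPolynomial.X 2 ^ 4
    - MvPolynomial.X 3 ^ 4 + 6 * MvPolynomial.X 2 ^ 2 * MvPolynomial.X 3 ^ 2
def q4 : MvPolynomial (Fin 4) ℂ :=
  2 * MvPolynomial.X 2 ^ 4 + 2 * MvPolynomial.X 3 ^ 4 - MvPolynomial.X 0 ^ 4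
    - MvPolynomial.X 1 ^ 4 + 6 * MvPolynomial.X 0 ^ 2 * MvPolynomial.X 1 ^ 2

/-- The exponent vector of the monomial `a₁ ^ a * a₂ ^ b * a₃ ^ c * a₄ ^ d`. -/
def expVec (a b c d : ℕ) : Fin 4 →₀ ℕ := Finsupp.equivFunOnFinite.symm ![a, b, c, d]

lemma eq_expVec (m : Fin 4 →₀ ℕ) : m = expVec (m 0) (m 1) (m 2) (m 3) := by
  ext i; fin_cases i <;> simp [expVec]

lemma monomial_expVec (a b c d : ℕ) (r : ℂ) :
    MvPolynomial.monomial (expVec a b c d) r = MvPolynomial.C r *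
      (MvPolynomial.X 0 ^ a * MvPolynomial.X 1 ^ b * MvPolynomial.X 2 ^ c *
        MvPolynomial.X 3 ^ d) := by
  rw [MvPolynomial.monomial_eq, Finsupp.prod_fintype _ _ (by simp)]
  simp [Fin.prod_univ_four, expVec]

/-- Evaluating the substituted polynomial amounts to evaluating at the transformed point. -/
lemma eval_msub (g : Matrix (Fin 4) (Fin 4) ℂ) (P : MvPolynomial (Fin 4) ℂ) (x : Fin 4 → ℂ) :
    MvPolynomial.eval x (msub g P) = MvPolynomial.eval (g *ᵥ x) P := by
  unfold msub
  induction P using MvPolynomial.induction_on with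
  | C a => simp
  | add p q hp hq => rw [map_add, map_add, map_add, hp, hq]
  | mul_X p i hp => rw [map_mul, map_mul, map_mul, hp]; simp [Matrix.mulVec, dotProduct]

/-- Substituting scalar multiples of permuted variables permutes and rescales coefficients. -/
lemma coeff_aeval_C_mul_X_perm {R ι : Type*} [CommSemiring R] [Fintype ι]
    (σ : Equiv.Perm ι) (u : ι → R) (m : ι →₀ ℕ) (P : MvPolynomial ι R) :
    MvPolynomial.coeff (m.mapDomain σ)
      (MvPolynomial.aeval (fun i => MvPolynomial.C (u i) * MvPolynomial.X (σ i)) P :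
        MvPolynomial ι R) =
      (∏ i, u i ^ m i) * MvPolynomial.coeff m P := by
  classical
  induction P using MvPolynomial.induction_on' with
  | add p q hp hq =>
    rw [map_add, MvPolynomial.coeff_add, MvPolynomial.coeff_add, hp, hq, mul_add]
  | monomial n r =>
    have h : (MvPolynomial.aeval (fun i => MvPolynomial.C (u i) * MvPolynomial.X (σ i))
        (MvPolynomial.monomial n r) : MvPolynomial ι R) =
        MvPolynomial.monomial (n.mapDomain σ) ((∏ i, u i ^ n i) * r) := by
      rw [MvPolynomial.aeval_monomial, MvPolynomial.monomial_eq,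
        Finsupp.prod_mapDomain_index_inj σ.injective,
        Finsupp.prod_fintype _ _ (by simp), Finsupp.prod_fintype _ _ (by simp)]
      simp only [mul_pow, Finset.prod_mul_distrib, map_mul, map_prod, map_pow,
        MvPolynomial.algebraMap_eq]
      ring
    rw [h, MvPolynomial.coeff_monomial, MvPolynomial.coeff_monomial]
    by_cases hmn : n = m
    · simp [hmn]
    · simp [hmn, (Finsupp.mapDomain_injective σ.injective).eq_iff]

lemma coeff_of_msub_g1_eq {P : MvPolynomial (Fin 4) ℂ} (h : msub g1 P = P) (a b c d : ℕ) :
    MvPolynomial.coeff (expVec a b c d) P =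
      (-1) ^ c * (-1) ^ d * MvPolynomial.coeff (expVec a b c d) P := by
  have key := coeff_aeval_C_mul_X_perm (Equiv.refl (Fin 4)) ![(1 : ℂ), 1, -1, -1]
    (expVec a b c d) P
  have hs : (fun i => MvPolynomial.C (![(1 : ℂ), 1, -1, -1] i) *
      MvPolynomial.X (Equiv.refl (Fin 4) i)) =
      fun i => ∑ j, MvPolynomial.C (g1 i j) * MvPolynomial.X (R := ℂ) j := by
    ext1 i; fin_cases i <;> simp [g1, Fin.sum_univ_four]
  have hm : (expVec a b c d).mapDomain (Equiv.refl (Fin 4)) = expVec a b c d := by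
    ext i; simp
  rw [hs, hm, ← msub, h] at key
  simpa [Fin.prod_univ_four, expVec] using key

lemma coeff_of_msub_g2_eq {P : MvPolynomial (Fin 4) ℂ} (h : msub g2 P = P) (a b c d : ℕ) :
    MvPolynomial.coeff (expVec b a c d) P =
      Complex.I ^ a * (-Complex.I) ^ b * (-1) ^ d * MvPolynomial.coeff (expVec a b c d) P := by
  have key := coeff_aeval_C_mul_X_perm (Equiv.swap (0 : Fin 4) 1)
    ![Complex.I, -Complex.I, 1, -1] (expVec a b c d) P
  have hs : (fun i => MvPolynomial.C (![Complex.I, -Complex.I, 1, -1] i) *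
      MvPolynomial.X (Equiv.swap (0 : Fin 4) 1 i)) =
      fun i => ∑ j, MvPolynomial.C (g2 i j) * MvPolynomial.X (R := ℂ) j := by
    ext1 i; fin_cases i <;> simp [g2, Fin.sum_univ_four, Equiv.swap_apply_def]
  have hm : (expVec a b c d).mapDomain (Equiv.swap (0 : Fin 4) 1) = expVec b a c d := by
    ext i; fin_cases i <;>
      simp [Finsupp.mapDomain_equiv_apply, expVec, Equiv.swap_apply_def]
  rw [hs, hm, ← msub, h] at key
  simpa [Fin.prod_univ_four, expVec] using key

lemma coeff_of_msub_g3_eq {P : MvPolynomial (Fin 4) ℂ} (h : msub g3 P = P) (a b c d : ℕ) :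
    MvPolynomial.coeff (expVec a b d c) P =
      (-1) ^ b * Complex.I ^ c * (-Complex.I) ^ d * MvPolynomial.coeff (expVec a b c d) P := by
  have key := coeff_aeval_C_mul_X_perm (Equiv.swap (2 : Fin 4) 3)
    ![1, -1, Complex.I, -Complex.I] (expVec a b c d) P
  have hs : (fun i => MvPolynomial.C (![1, -1, Complex.I, -Complex.I] i) *
      MvPolynomial.X (Equiv.swap (2 : Fin 4) 3 i)) =
      fun i => ∑ j, MvPolynomial.C (g3 i j) * MvPolynomial.X (R := ℂ) j := by
    ext1 i; fin_cases i <;> simp [g3, Fin.sum_univ_four, Equiv.swap_apply_def]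
  have hm : (expVec a b c d).mapDomain (Equiv.swap (2 : Fin 4) 3) = expVec a b d c := by
    ext i; fin_cases i <;>
      simp [Finsupp.mapDomain_equiv_apply, expVec, Equiv.swap_apply_def]
  rw [hs, hm, ← msub, h] at key
  simpa [Fin.prod_univ_four, expVec] using key

lemma coeff_of_msub_g4_eq {P : MvPolynomial (Fin 4) ℂ} (h : msub g4 P = P) (a b c d : ℕ) :
    MvPolynomial.coeff (expVec b a d c) P =
      (-1) ^ a * (-1) ^ b * (-1) ^ c * (-1) ^ d * MvPolynomial.coeff (expVec a b c d) P := by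
  have key := coeff_aeval_C_mul_X_perm (Equiv.swap (0 : Fin 4) 1 * Equiv.swap (2 : Fin 4) 3)
    ![(-1 : ℂ), -1, -1, -1] (expVec a b c d) P
  have hs : (fun i => MvPolynomial.C (![(-1 : ℂ), -1, -1, -1] i) *
      MvPolynomial.X ((Equiv.swap (0 : Fin 4) 1 * Equiv.swap (2 : Fin 4) 3) i)) =
      fun i => ∑ j, MvPolynomial.C (g4 i j) * MvPolynomial.X (R := ℂ) j := by
    ext1 i; fin_cases i <;> simp [g4, Fin.sum_univ_four, Equiv.swap_apply_def]
  have hm : (expVec a b c d).mapDomain (Equiv.swap (0 : Fin 4) 1 * Equiv.swap (2 : Fin 4) 3) =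
      expVec b a d c := by
    ext i
    rw [Finsupp.mapDomain_equiv_apply]
    fin_cases i <;> simp [expVec, Equiv.swap_apply_def, Equiv.Perm.mul_def]
  rw [hs, hm, ← msub, h] at key
  simpa [Fin.prod_univ_four, expVec] using key

/-- A quartic form is the sum of its terms, listed by exponents. -/
lemma quartic_eq_sum {P : MvPolynomial (Fin 4) ℂ} (hP : P.IsHomogeneous 4) :
    P = ∑ a ∈ Finset.range 5, ∑ b ∈ Finset.range (5 - a), ∑ c ∈ Finset.range (5 - a - b),
      MvPolynomial.monomial (expVec a b c (4 - a - b - c))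
        (MvPolynomial.coeff (expVec a b c (4 - a - b - c)) P) := by
  have hdeg {m : Fin 4 →₀ ℕ} (hm : m ∈ P.support) : m 0 + m 1 + m 2 + m 3 = 4 := by
    have h := hP (MvPolynomial.mem_support_iff.mp hm)
    rw [Pi.one_def, ← Finsupp.degree_eq_weight_one, Finsupp.degree_eq_sum, Fin.sum_univ_four] at h
    exact h
  conv_lhs => rw [P.as_sum]
  simp only [Finset.sum_sigma']
  refine Finset.sum_bij_ne_zero (fun m _ _ => ⟨m 0, m 1, m 2⟩) ?_ ?_ ?_ ?_
  · intro m hm _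
    have := hdeg hm
    simp only [Finset.mem_sigma, Finset.mem_range]
    omega
  · intro m hm _ n hn _ h
    have h₁ := hdeg hm
    have h₂ := hdeg hn
    simp only [Sigma.mk.injEq, heq_eq_eq] at h
    obtain ⟨e₀, e₁, e₂⟩ := h
    have e₃ : m 3 = n 3 := by omega
    rw [eq_expVec m, eq_expVec n, e₀, e₁, e₂, e₃]
  · rintro ⟨a, b, c⟩ _ h
    refine ⟨expVec a b c (4 - a - b - c), ?_, h, by simp [expVec]⟩
    simpa using h
  · intro m hm _
    have := hdeg hm
    have e : 4 - m 0 - m 1 - m 2 = m 3 := by omega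
    simp only [e, ← eq_expVec m]

/-- Invariance under the monomial matrices `g₁, …, g₄` leaves a seven-dimensional space. -/
lemma quartic_eq_of_monomial_invariant {P : MvPolynomial (Fin 4) ℂ} (hP : P.IsHomogeneous 4)
    (h1 : msub g1 P = P) (h2 : msub g2 P = P) (h3 : msub g3 P = P) (h4 : msub g4 P = P) :
    ∃ α β γ r s t u : ℂ, P = α • q0 + β • q1 + γ • q2 +
      r • (MvPolynomial.X 0 ^ 4 + MvPolynomial.X 1 ^ 4) +
      s • (MvPolynomial.X 0 ^ 2 * MvPolynomial.X 1 ^ 2) +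
      t • (MvPolynomial.X 2 ^ 4 + MvPolynomial.X 3 ^ 4) +
      u • (MvPolynomial.X 2 ^ 2 * MvPolynomial.X 3 ^ 2) := by
  have hodd {a b c d : ℕ} (h : Odd (c + d)) :
      MvPolynomial.coeff (expVec a b c d) P = 0 := by
    have := coeff_of_msub_g1_eq h1 a b c d
    rw [← pow_add, h.neg_one_pow] at this
    grind
  have k2 := coeff_of_msub_g2_eq h2
  have k3 := coeff_of_msub_g3_eq h3
  have k4 := coeff_of_msub_g4_eq h4
  have hI := Complex.I_sq
  have z3100 : MvPolynomial.coeff (expVec 3 1 0 0) P = 0 := by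
    grind [k2 1 3 0 0, k4 1 3 0 0]
  have z1300 : MvPolynomial.coeff (expVec 1 3 0 0) P = 0 := by
    grind [k4 3 1 0 0]
  have z0031 : MvPolynomial.coeff (expVec 0 0 3 1) P = 0 := by
    grind [k3 0 0 1 3, k4 0 0 1 3]
  have z0013 : MvPolynomial.coeff (expVec 0 0 1 3) P = 0 := by
    grind [k4 0 0 3 1]
  have z1111 : MvPolynomial.coeff (expVec 1 1 1 1) P = 0 := by
    grind [k2 1 1 1 1]
  have e0400 : MvPolynomial.coeff (expVec 0 4 0 0) P =
      MvPolynomial.coeff (expVec 4 0 0 0) P := by grind [k4 4 0 0 0]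
  have e0004 : MvPolynomial.coeff (expVec 0 0 0 4) P =
      MvPolynomial.coeff (expVec 0 0 4 0) P := by grind [k4 0 0 4 0]
  have e0220 : MvPolynomial.coeff (expVec 0 2 2 0) P =
      -MvPolynomial.coeff (expVec 2 0 2 0) P := by grind [k2 2 0 2 0]
  have e2002 : MvPolynomial.coeff (expVec 2 0 0 2) P =
      -MvPolynomial.coeff (expVec 2 0 2 0) P := by grind [k3 2 0 2 0]
  have e0202 : MvPolynomial.coeff (expVec 0 2 0 2) P =
      MvPolynomial.coeff (expVec 2 0 2 0) P := by grind [k4 2 0 2 0]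
  have e0211 : MvPolynomial.coeff (expVec 0 2 1 1) P =
      MvPolynomial.coeff (expVec 2 0 1 1) P := by grind [k4 2 0 1 1]
  have e1102 : MvPolynomial.coeff (expVec 1 1 0 2) P =
      MvPolynomial.coeff (expVec 1 1 2 0) P := by grind [k4 1 1 2 0]
  refine ⟨MvPolynomial.coeff (expVec 2 0 2 0) P, MvPolynomial.coeff (expVec 2 0 1 1) P,
    MvPolynomial.coeff (expVec 1 1 2 0) P, MvPolynomial.coeff (expVec 4 0 0 0) P,
    MvPolynomial.coeff (expVec 2 2 0 0) P, MvPolynomial.coeff (expVec 0 0 4 0) P,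
    MvPolynomial.coeff (expVec 0 0 2 2) P, ?_⟩
  conv_lhs => rw [quartic_eq_sum hP]
  simp (disch := decide) only [Finset.sum_range_succ, Finset.sum_range_zero, Nat.reduceSub, hodd,
    z3100, z1300, z0031, z0013, z1111, e0400, e0004, e0220, e2002, e0202, e0211, e1102,
    monomial_expVec, MvPolynomial.smul_eq_C_mul, q0, q1, q2, map_neg, map_zero]
  ring

theorem span_quartics_invariant {P : MvPolynomial (Fin 4) ℂ}
    (hP : P ∈ Submodule.span ℂ ({q0, q1, q2, q3, q4} : Set (MvPolynomial (Fin 4) ℂ))) :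
    msub g1 P = P ∧ msub g2 P = P ∧ msub g3 P = P ∧ msub g4 P = P ∧ msub g5 P = P := by
  have hI := Complex.I_sq
  induction hP using Submodule.span_induction with
  | zero => simp [msub]
  | add p q _ _ hp hq => simp_all [msub]
  | smul r p _ hp => simp_all [msub]
  | mem q hq =>
    simp only [Set.mem_insert_iff, Set.mem_singleton_iff] at hq
    refine ⟨?_, ?_, ?_, ?_, ?_⟩ <;> refine MvPolynomial.funext fun x => ?_ <;>
      rw [eval_msub] <;> rcases hq with rfl | rfl | rfl | rfl | rfl <;>
      simp [q0, q1, q2, q3, q4, g1, g2, g3, g4, g5, dotProduct,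
        Fin.sum_univ_four] <;> grind

theorem linearIndependent_quartics : LinearIndependent ℂ ![q0, q1, q2, q3, q4] := by
  rw [Fintype.linearIndependent_iff]
  intro r hr
  have h (x : Fin 4 → ℂ) := congrArg (MvPolynomial.eval x) hr
  simp only [Fin.sum_univ_five, q0, q1, q2, q3, q4] at h
  have e₁ := h ![1, 0, 0, 0]
  have e₂ := h ![0, 0, 1, 0]
  have e₃ := h ![1, 0, 1, 0]
  have e₄ := h ![1, 0, 1, 1]
  have e₅ := h ![1, 1, 1, 0]
  simp at e₁ e₂ e₃ e₄ e₅
  intro i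
  fin_cases i <;> simp <;> grind

/-- A homogeneous quartic is invariant under the substitution action of each of the five
generators `g₁, …, g₅` of the Heisenberg-type group `F` if and only if it lies in the span
of the five quartics `q₀, …, q₄`; in particular the space of `F`-invariant quartic forms has
dimension exactly 5. -/
theorem F_invariant_quartics_eq_U5 :
    (∀ P ∈ MvPolynomial.homogeneousSubmodule (Fin 4) ℂ 4,
      ((msub g1 P = P ∧ msub g2 P = P ∧ msub g3 P = P ∧ msub g4 P = P ∧ msub g5 P = P) ↔
        P ∈ Submodule.span ℂ ({q0, q1, q2, q3, q4} : Set (MvPolynomial (Fin 4) ℂ)))) ∧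
    Module.finrank ℂ
      ↥(Submodule.span ℂ ({q0, q1, q2, q3, q4} : Set (MvPolynomial (Fin 4) ℂ))) = 5 := by
  refine ⟨fun P hP => ⟨?_, span_quartics_invariant⟩, ?_⟩
  · rintro ⟨h1, h2, h3, h4, h5⟩
    obtain ⟨α, β, γ, r, s, t, u, rfl⟩ := quartic_eq_of_monomial_invariant
      ((MvPolynomial.mem_homogeneousSubmodule 4 P).mp hP) h1 h2 h3 h4
    have hI := Complex.I_sq
    have h (x : Fin 4 → ℂ) := (eval_msub g5 _ x).symm.trans (congrArg (MvPolynomial.eval x) h5)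
    have e₁ := h ![1, 0, 0, 0]
    have e₂ := h ![0, 0, 1, 0]
    simp [q0, q1, q2, g5, MvPolynomial.smul_eval] at e₁ e₂
    have hr : r = (2 * u - s) / 6 := by grind
    have ht : t = (2 * s - u) / 6 := by grind
    simp only [Submodule.mem_span_insert, Submodule.mem_span_singleton]
    refine ⟨α, _, ⟨β, _, ⟨γ, _, ⟨u / 6, _, ⟨s / 6, rfl⟩, rfl⟩, rfl⟩, rfl⟩, ?_⟩
    refine MvPolynomial.funext fun x => ?_
    simp [q0, q1, q2, q3, q4, MvPolynomial.smul_eval, hr, ht]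
    ring
  · have hset : ({q0, q1, q2, q3, q4} : Set (MvPolynomial (Fin 4) ℂ)) =
        Set.range ![q0, q1, q2, q3, q4] := by
      simp only [Matrix.range_cons, Matrix.range_empty, Set.singleton_union, Set.union_empty]
    rw [hset, finrank_span_eq_card linearIndependent_quartics, Fintype.card_fin]

end
end

section
/- Let M be the 8x8 rational matrix with rows (0,0,0,1,1,0,0,0), (1,0,0,0,0,1,0,0), (0,1,0,0,0,0,1,0), (0,0,3,0,0,0,0,1), (0,0,2,0,0,0,0,1), (0,0,0,2,3,0,0,0), (0,0,0,0,0,1,0,0), (0,0,0,0,0,0,1,0). Then the characteristic polynomial of M is X^8 - 34*X^4 + 1, and the complex eigenvalues of M are exactly the eight pairwise distinct numbers (sqrt(2)+1)*i^k and (sqrt(2)-1)*i^k for k = 0,1,2,3, each a simple root of the characteristic polynomial; in particular the eigenvalues of maximal modulus are obtained from one another by multiplication by fourth roots of unity and all have multiplicity one. -/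
open Polynomial

/-- The matrix of quantum multiplication by the hyperplane class `σ₁` (at `q = 1`) on the
quantum cohomology of a smooth codimension-four linear section of the spinor tenfold, in the
Schubert-type basis `σ₀, σ₁, σ₂, σ₃', σ₃'', σ₄, σ₅, σ₆`. -/
def Mq : Matrix (Fin 8) (Fin 8) ℚ :=
  !![0, 0, 0, 1, 1, 0, 0, 0;
     1, 0, 0, 0, 0, 1, 0, 0;
     0, 1, 0, 0, 0, 0, 1, 0;
     0, 0, 3, 0, 0, 0, 0, 1;
     0, 0, 2, 0, 0, 0, 0, 1;
     0, 0, 0, 2, 3, 0, 0, 0;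
     0, 0, 0, 0, 0, 1, 0, 0;
     0, 0, 0, 0, 0, 0, 1, 0]

/-- The eight eigenvalues `(√2 ± 1)·iᵏ`, `k = 0, 1, 2, 3`. -/
noncomputable def ev : Fin 8 → ℂ :=
  ![((Real.sqrt 2 : ℂ) + 1), ((Real.sqrt 2 : ℂ) + 1) * Complex.I,
    ((Real.sqrt 2 : ℂ) + 1) * Complex.I ^ 2, ((Real.sqrt 2 : ℂ) + 1) * Complex.I ^ 3,
    ((Real.sqrt 2 : ℂ) - 1), ((Real.sqrt 2 : ℂ) - 1) * Complex.I,
    ((Real.sqrt 2 : ℂ) - 1) * Complex.I ^ 2, ((Real.sqrt 2 : ℂ) - 1) * Complex.I ^ 3]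

open scoped Matrix

/-- A monic polynomial of degree `n` annihilating a cyclic vector of an `n × n` matrix is the
characteristic polynomial. -/
theorem Matrix.charpoly_eq_of_linearIndependent_pow_mulVec {K : Type*} [Field K] {n : ℕ}
    (M : Matrix (Fin n) (Fin n) K) (v : Fin n → K)
    (hv : LinearIndependent K fun k : Fin n => (M ^ (k : ℕ)) *ᵥ v)
    {p : K[X]} (hp : p.Monic) (hdeg : p.natDegree = n) (hpv : aeval M p *ᵥ v = 0) :
    M.charpoly = p := by
  by_contra hne
  have hr : M.charpoly - p ≠ 0 := sub_ne_zero.mpr hne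
  have hlt : (M.charpoly - p).natDegree < n := by
    have hd : M.charpoly.degree = n := by simp [M.charpoly_degree_eq_dim]
    rw [natDegree_lt_iff_degree_lt hr, ← hd]
    refine degree_sub_lt_left ?_ M.charpoly_monic.ne_zero ?_
    · rw [hd, degree_eq_natDegree hp.ne_zero, hdeg]
    · rw [M.charpoly_monic.leadingCoeff, hp.leadingCoeff]
  have hzero : aeval M (M.charpoly - p) *ᵥ v = 0 := by
    rw [map_sub, M.aeval_self_charpoly, zero_sub, Matrix.neg_mulVec, hpv, neg_zero]
  rw [aeval_eq_sum_range' hlt, Matrix.sum_mulVec, Finset.sum_range] at hzero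
  simp only [Matrix.smul_mulVec] at hzero
  have hcoeff := Fintype.linearIndependent_iff.mp hv _ hzero
  exact hr (leadingCoeff_eq_zero.mp (hcoeff ⟨_, hlt⟩))

theorem Mq_mulVec (a b c d e f g h : ℚ) :
    Mq *ᵥ ![a, b, c, d, e, f, g, h] =
      ![d + e, a + f, b + g, 3 * c + h, 2 * c + h, 2 * d + 3 * e, f, g] := by
  ext i
  fin_cases i <;> simp [Mq, Matrix.mulVec, dotProduct, Fin.sum_univ_succ]

theorem charpoly_Mq : Mq.charpoly = X ^ 8 - 34 * X ^ 4 + 1 := by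
  have hdeg : (X ^ 8 - 34 * X ^ 4 + 1 : ℚ[X]).natDegree = 8 := by compute_degree!
  refine Mq.charpoly_eq_of_linearIndependent_pow_mulVec ![1, 0, 0, 0, 0, 0, 0, 0] ?_
    (by monicity!) hdeg ?_
  · rw [Fintype.linearIndependent_iff]
    intro g hg
    simp only [Fin.sum_univ_eight, Fin.coe_ofNat_eq_mod, Nat.reduceMod, pow_succ', pow_zero,
      mul_one, Matrix.one_mulVec, ← Matrix.mulVec_mulVec, Mq_mulVec] at hg
    have h0 := congrFun hg 0
    have h1 := congrFun hg 1
    have h2 := congrFun hg 2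
    have h3 := congrFun hg 3
    have h4 := congrFun hg 4
    have h5 := congrFun hg 5
    have h6 := congrFun hg 6
    have h7 := congrFun hg 7
    simp only [Pi.add_apply, Pi.smul_apply, Pi.zero_apply, Matrix.cons_val, smul_eq_mul]
      at h0 h1 h2 h3 h4 h5 h6 h7
    intro i
    clear hg
    fin_cases i <;> simp <;> linarith
  · have h34 : (34 : ℚ[X]) = C 34 := rfl
    simp only [h34, map_add, map_sub, map_mul, aeval_X, aeval_C, map_one,
      Matrix.add_mulVec, Matrix.sub_mulVec, ← Matrix.mulVec_mulVec, Matrix.one_mulVec,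
      Algebra.algebraMap_eq_smul_one, Matrix.smul_mulVec, pow_succ', pow_zero, mul_one,
      Mq_mulVec]
    ext i
    fin_cases i <;> norm_num

theorem ofReal_sqrt_two_sq : (Real.sqrt 2 : ℂ) ^ 2 = 2 := by
  rw [← Complex.ofReal_pow, Real.sq_sqrt (by norm_num)]
  norm_num

theorem ev_injective : Function.Injective ev := by
  have h1 : 1 < Real.sqrt 2 := Real.lt_sqrt_of_sq_lt (by norm_num)
  intro i j hij
  fin_cases i <;> fin_cases j <;>
    first
    | rfl
    | (exfalso
       simp [ev, Complex.ext_iff, pow_succ] at hij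
       grind)

theorem prod_X_sub_C_ev : ∏ i, (X - C (ev i)) = (X ^ 8 - 34 * X ^ 4 + 1 : ℂ[X]) := by
  have quartic (a : ℂ) : (X - C a) * (X - C (a * Complex.I)) * (X - C (a * Complex.I ^ 2)) *
      (X - C (a * Complex.I ^ 3)) = X ^ 4 - C (a ^ 4) := by
    have hI : (C Complex.I : ℂ[X]) ^ 2 = -1 := by rw [← C_pow, Complex.I_sq, C_neg, C_1]
    simp only [C_mul, C_pow]
    grind
  have hs : (C (Real.sqrt 2 : ℂ) : ℂ[X]) ^ 2 = 2 := by
    rw [← C_pow, ofReal_sqrt_two_sq]; rfl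
  have hp := quartic (Real.sqrt 2 + 1)
  have hm := quartic (Real.sqrt 2 - 1)
  calc ∏ i, (X - C (ev i))
      = (X ^ 4 - C (((Real.sqrt 2 : ℂ) + 1) ^ 4)) * (X ^ 4 - C (((Real.sqrt 2 : ℂ) - 1) ^ 4)) := by
        rw [← hp, ← hm, Fin.prod_univ_eight]
        simp only [ev, Matrix.cons_val]
        ring
    _ = X ^ 8 - 34 * X ^ 4 + 1 := by
        simp only [C_pow, C_add, C_sub, C_1]
        linear_combination ((C (Real.sqrt 2 : ℂ) ^ 2) * ((C (Real.sqrt 2 : ℂ) ^ 2 - 1) ^ 2 + 1) -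
          2 * (C (Real.sqrt 2 : ℂ) ^ 2 + 8) * X ^ 4) * hs

/-- The characteristic polynomial of the quantum multiplication matrix is `X⁸ - 34X⁴ + 1`,
and its complex eigenvalues are exactly the eight pairwise distinct numbers `(√2 ± 1)·iᵏ`,
`k = 0, 1, 2, 3`, each being a simple root of the characteristic polynomial.  In particular
the eigenvalues of maximal modulus all have multiplicity one and are obtained from one
another by multiplication by fourth roots of unity, as predicted by Conjecture O. -/
theorem conjecture_O_for_codim_four_sections :
    Mq.charpoly = X ^ 8 - 34 * X ^ 4 + 1 ∧
    Function.Injective ev ∧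
    (Mq.map (algebraMap ℚ ℂ)).charpoly.roots =
      {ev 0, ev 1, ev 2, ev 3, ev 4, ev 5, ev 6, ev 7} := by
  refine ⟨charpoly_Mq, ev_injective, ?_⟩
  have h : (Mq.map (algebraMap ℚ ℂ)).charpoly =
      (({ev 0, ev 1, ev 2, ev 3, ev 4, ev 5, ev 6, ev 7} : Multiset ℂ).map
        (X - C ·)).prod := by
    rw [Matrix.charpoly_map, charpoly_Mq]
    simpa [Fin.prod_univ_eight, mul_assoc] using prod_X_sub_C_ev.symm
  rw [h, roots_multiset_prod_X_sub_C]
end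

section
/- Let V be a 10-dimensional complex vector space equipped with a nondegenerate symmetric bilinear form, let A be a 3-dimensional totally isotropic subspace, B5 a 5-dimensional totally isotropic subspace, and B2 a 2-dimensional subspace of B5. Assume A and B5 intersect trivially, the subspace B5 meet A-perp has dimension 2, and B2 meets A-perp trivially. Then there is at most one pair (U, W) of 5-dimensional totally isotropic subspaces of V such that A is contained in U, B2 is contained in W, the intersection B5 meet W has dimension 4, and the intersection U meet W has dimension 3; moreover any such U necessarily equals A + (B5 meet A-perp). -/
variable {V : Type*} [AddCommGroup V] [Module ℂ V]

/-- A subspace is totally isotropic for the bilinear form `B` when `B` vanishes identically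
on it. -/
def IsTotIso (B : V →ₗ[ℂ] V →ₗ[ℂ] ℂ) (U : Submodule ℂ V) : Prop :=
  ∀ x ∈ U, ∀ y ∈ U, B x y = 0

/-- The orthogonal complement of a subspace with respect to the bilinear form `B`. -/
def perp (B : V →ₗ[ℂ] V →ₗ[ℂ] ℂ) (A : Submodule ℂ V) : Submodule ℂ V where
  carrier := {v | ∀ a ∈ A, B a v = 0}
  add_mem' := by
    intro x y hx hy a ha
    simp [map_add, hx a ha, hy a ha]
  zero_mem' := by
    intro a ha
    simp
  smul_mem' := by
    intro c x hx a ha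
    simp [hx a ha]

/-- The conditions on a pair `(U, W)` of maximal isotropic subspaces: `A ⊆ U`, `B₂ ⊆ W`,
`dim (B₅ ∩ W) = 4` and `dim (U ∩ W) = 3`. -/
def GoodPair (B : V →ₗ[ℂ] V →ₗ[ℂ] ℂ) (A B5 B2 U W : Submodule ℂ V) : Prop :=
  IsTotIso B U ∧ Module.finrank ℂ ↥U = 5 ∧ IsTotIso B W ∧ Module.finrank ℂ ↥W = 5 ∧
  A ≤ U ∧ B2 ≤ W ∧ Module.finrank ℂ ↥(B5 ⊓ W) = 4 ∧ Module.finrank ℂ ↥(U ⊓ W) = 3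

/-- In a nondegenerate symmetric space, `dim A + dim A^⊥ = dim V`. -/
theorem finrank_add_finrank_perp [FiniteDimensional ℂ V] {B : V →ₗ[ℂ] V →ₗ[ℂ] ℂ}
    (hsymm : ∀ x y : V, B x y = B y x) (hnd : ∀ x : V, (∀ y : V, B x y = 0) → x = 0)
    (A : Submodule ℂ V) :
    Module.finrank ℂ A + Module.finrank ℂ (perp B A) = Module.finrank ℂ V := by
  have hrefl : LinearMap.IsRefl B := fun x y h => by rw [hsymm, h]
  have hnondeg : LinearMap.BilinForm.Nondegenerate B :=
    hrefl.nondegenerate_iff_separatingLeft.mpr hnd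
  have hperp : perp B A = LinearMap.BilinForm.orthogonal B A := rfl
  have hfin := LinearMap.BilinForm.finrank_orthogonal hnondeg A
  have hle := A.finrank_le
  rw [hperp, hfin]
  omega

/-- A totally isotropic subspace of half the dimension of the space is its own orthogonal
complement. -/
theorem IsTotIso.perp_eq_self [FiniteDimensional ℂ V] {B : V →ₗ[ℂ] V →ₗ[ℂ] ℂ}
    (hsymm : ∀ x y : V, B x y = B y x) (hnd : ∀ x : V, (∀ y : V, B x y = 0) → x = 0)
    {W : Submodule ℂ V} (hW : IsTotIso B W)
    (hdim : Module.finrank ℂ V = 2 * Module.finrank ℂ W) : perp B W = W := by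
  have hsum := finrank_add_finrank_perp hsymm hnd W
  have hle : W ≤ perp B W := fun x hx a ha => hW a ha x hx
  exact (Submodule.eq_of_le_of_finrank_le hle (by omega)).symm

/-- If two maximal isotropic subspaces `P` and `W` meet in a common hyperplane, then a maximal
isotropic subspace meeting `P` in the same hyperplane equals `W`. -/
theorem IsTotIso.eq_of_inf_eq_inf [FiniteDimensional ℂ V] {B : V →ₗ[ℂ] V →ₗ[ℂ] ℂ}
    (hsymm : ∀ x y : V, B x y = B y x) (hnd : ∀ x : V, (∀ y : V, B x y = 0) → x = 0)
    {P W W' : Submodule ℂ V} (hP : IsTotIso B P) (hW : IsTotIso B W) (hW' : IsTotIso B W')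
    (hPdim : Module.finrank ℂ V = 2 * Module.finrank ℂ P)
    (hWdim : Module.finrank ℂ W = Module.finrank ℂ P)
    (hWdim' : Module.finrank ℂ W' = Module.finrank ℂ P)
    (hinf : Module.finrank ℂ ↥(P ⊓ W) + 1 = Module.finrank ℂ P)
    (heq : P ⊓ W = P ⊓ W') : W = W' := by
  have hsup : P ⊔ W = perp B (P ⊓ W) := by
    refine Submodule.eq_of_le_of_finrank_le (sup_le ?_ ?_) ?_
    · exact fun x hx a ha => hP a ha.1 x hx
    · exact fun x hx a ha => hW a ha.2 x hx
    · have h₁ := finrank_add_finrank_perp hsymm hnd (P ⊓ W)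
      have h₂ := Submodule.finrank_sup_add_finrank_inf_eq P W
      omega
  refine (Submodule.eq_of_le_of_finrank_eq (fun x hx => ?_) (by omega)).symm
  have hx' : x ∈ P ⊔ W := by
    rw [hsup, heq]
    exact fun a ha => hW' a ha.2 x hx
  obtain ⟨p, hp, w, hw, rfl⟩ := Submodule.mem_sup.mp hx'
  have hpw : B p w = 0 := by
    have h := hW' _ hx _ hx
    simp only [map_add, LinearMap.add_apply, hP p hp p hp, hW w hw w hw, hsymm w p] at h
    linear_combination h / 2
  by_cases hwP : w ∈ P
  · have hmem : p + w ∈ P ⊓ W' := ⟨P.add_mem hp hwP, hx⟩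
    rw [← heq] at hmem
    exact hmem.2
  · have hspan : P ⊓ W ⊔ Submodule.span ℂ {w} = W := by
      refine Submodule.eq_of_le_of_finrank_le
        (sup_le inf_le_right (by simpa using hw)) ?_
      have hlt : P ⊓ W < P ⊓ W ⊔ Submodule.span ℂ {w} :=
        left_lt_sup.mpr fun h => hwP (h (Submodule.mem_span_singleton_self w)).1
      have := Submodule.finrank_lt_finrank_of_lt hlt
      omega
    refine W.add_mem ?_ hw
    rw [← hW.perp_eq_self hsymm hnd (by omega)]
    intro a ha
    rw [← hspan] at ha
    obtain ⟨l, hl, z, hz, rfl⟩ := Submodule.mem_sup.mp ha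
    obtain ⟨c, rfl⟩ := Submodule.mem_span_singleton.mp hz
    simp [hP l hl.1 p hp, hsymm w p, hpw]

/-- For a good pair `(U, W)`, the plane `B₅ ∩ A^⊥` lies in both `U` and `W`. -/
theorem GoodPair.inf_perp_le [FiniteDimensional ℂ V] {B : V →ₗ[ℂ] V →ₗ[ℂ] ℂ}
    {A B5 B2 U W : Submodule ℂ V} (h : GoodPair B A B5 B2 U W)
    (hB5A : Module.finrank ℂ ↥(B5 ⊓ perp B A) = 2) : B5 ⊓ perp B A ≤ U ⊓ W := by
  obtain ⟨hU, -, -, hWdim, hAU, -, hBW, hUW⟩ := h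
  have heq : (U ⊓ W) ⊓ (B5 ⊓ W) = B5 ⊓ perp B A := by
    refine Submodule.eq_of_le_of_finrank_le ?_ ?_
    · exact fun x hx => ⟨hx.2.1, fun a ha => hU a (hAU ha) x hx.1.1⟩
    · have h₁ := Submodule.finrank_sup_add_finrank_inf_eq (U ⊓ W) (B5 ⊓ W)
      have h₂ : Module.finrank ℂ ↥((U ⊓ W) ⊔ (B5 ⊓ W)) ≤ Module.finrank ℂ W :=
        Submodule.finrank_mono (sup_le inf_le_right inf_le_right)
      omega
  rw [← heq]
  exact inf_le_left

/-- For a good pair `(U, W)`, the first member is `A + (B₅ ∩ A^⊥)`. -/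
theorem GoodPair.left_eq [FiniteDimensional ℂ V] {B : V →ₗ[ℂ] V →ₗ[ℂ] ℂ}
    {A B5 B2 U W : Submodule ℂ V} (h : GoodPair B A B5 B2 U W)
    (hA3 : Module.finrank ℂ A = 3) (hAB5 : A ⊓ B5 = ⊥)
    (hB5A : Module.finrank ℂ ↥(B5 ⊓ perp B A) = 2) : U = A ⊔ (B5 ⊓ perp B A) := by
  have hle := h.inf_perp_le hB5A
  obtain ⟨-, hUdim, -, -, hAU, -, -, -⟩ := h
  refine (Submodule.eq_of_le_of_finrank_le (sup_le hAU (hle.trans inf_le_left)) ?_).symm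
  have hsum := Submodule.finrank_sup_add_finrank_inf_eq A (B5 ⊓ perp B A)
  rw [← inf_assoc, hAB5, bot_inf_eq, finrank_bot] at hsum
  omega

/-- For a good pair `(U, W)`, the second member meets `B₅` in `B₂ + (B₅ ∩ A^⊥)`. -/
theorem GoodPair.inf_right_eq [FiniteDimensional ℂ V] {B : V →ₗ[ℂ] V →ₗ[ℂ] ℂ}
    {A B5 B2 U W : Submodule ℂ V} (h : GoodPair B A B5 B2 U W)
    (hB2 : B2 ≤ B5) (hB22 : Module.finrank ℂ B2 = 2)
    (hB5A : Module.finrank ℂ ↥(B5 ⊓ perp B A) = 2) (hB2A : B2 ⊓ perp B A = ⊥) :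
    B5 ⊓ W = B2 ⊔ (B5 ⊓ perp B A) := by
  have hle := h.inf_perp_le hB5A
  obtain ⟨-, -, -, -, -, hB2W, hBW, -⟩ := h
  refine (Submodule.eq_of_le_of_finrank_le
    (sup_le (le_inf hB2 hB2W) (le_inf inf_le_left (hle.trans inf_le_right))) ?_).symm
  have hsum := Submodule.finrank_sup_add_finrank_inf_eq B2 (B5 ⊓ perp B A)
  rw [← inf_assoc, inf_eq_left.mpr hB2, hB2A, finrank_bot] at hsum
  omega

/-- Through a general line and a general plane of the spinor tenfold there passes at most one
connecting line: given a nondegenerate symmetric bilinear form on a 10-dimensional space, a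
3-dimensional isotropic subspace `A`, a 5-dimensional isotropic subspace `B₅` and a plane
`B₂ ⊆ B₅` in general position, there is at most one pair `(U, W)` of maximal isotropic
subspaces with `A ⊆ U`, `B₂ ⊆ W`, `dim (B₅ ∩ W) = 4` and `dim (U ∩ W) = 3`; moreover any
such `U` equals `A + (B₅ ∩ A^⊥)`. -/
theorem unique_line_through_line_and_plane
    (V : Type*) [AddCommGroup V] [Module ℂ V] [FiniteDimensional ℂ V]
    (hV : Module.finrank ℂ V = 10)
    (B : V →ₗ[ℂ] V →ₗ[ℂ] ℂ)
    (hsymm : ∀ x y : V, B x y = B y x)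
    (hnd : ∀ x : V, (∀ y : V, B x y = 0) → x = 0)
    (A B5 B2 : Submodule ℂ V)
    (hA : IsTotIso B A) (hA3 : Module.finrank ℂ ↥A = 3)
    (hB5 : IsTotIso B B5) (hB55 : Module.finrank ℂ ↥B5 = 5)
    (hB2 : B2 ≤ B5) (hB22 : Module.finrank ℂ ↥B2 = 2)
    (hAB5 : A ⊓ B5 = ⊥)
    (hB5A : Module.finrank ℂ ↥(B5 ⊓ perp B A) = 2)
    (hB2A : B2 ⊓ perp B A = ⊥) :
    (∀ U W U' W' : Submodule ℂ V,
      GoodPair B A B5 B2 U W → GoodPair B A B5 B2 U' W' → U = U' ∧ W = W') ∧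
    (∀ U W : Submodule ℂ V, GoodPair B A B5 B2 U W → U = A ⊔ (B5 ⊓ perp B A)) := by
  refine ⟨fun U W U' W' h h' => ⟨?_, ?_⟩, fun U W h => h.left_eq hA3 hAB5 hB5A⟩
  · rw [h.left_eq hA3 hAB5 hB5A, h'.left_eq hA3 hAB5 hB5A]
  · have heq : B5 ⊓ W = B5 ⊓ W' := by
      rw [h.inf_right_eq hB2 hB22 hB5A hB2A, h'.inf_right_eq hB2 hB22 hB5A hB2A]
    obtain ⟨-, -, hW, hWdim, -, -, hBW, -⟩ := h
    obtain ⟨-, -, hW', hWdim', -, -, -, -⟩ := h'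
    exact hB5.eq_of_inf_eq_inf hsymm hnd hW hW' (by omega) (by omega) (by omega) (by omega) heq
end
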